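/- arXiv:1805.02323 — 2 statements merged into one kernel-verified Lean document; each statement's English description precedes it below -/
import Mathlib

section
/- Patch profile of the maximizer: let (ω^λ, x_{p+1}^λ, …, x_k^λ) be a maximizer of ℰ over N_p^λ × B̄_δ(x̄_{p+1}) × ⋯ × B̄_δ(x̄_k), with (a.e. unique) decomposition ω^λ = Σ_{i=1}^p ω_i^λ and ψ^λ = ∫_D G(·,y)ω^λ(y)dy. Then for each i = 1,…,p there exists c_i^λ ∈ ℝ such that ω_i^λ = sgn(κ_i)·λ·1_{A_i^λ} a.e., where A_i^λ = { x ∈ D : sgn(κ_i)(ψ^λ(x) + Σ_{j=p+1}^k κ_jG(x_j^λ,x)) > c_i^λ } ∩ B_δ(x̄_i); moreover c_i^λ equals the essential infimum of sgn(κ_i)(ψ^λ + Σ_{j=p+1}^k κ_jG(x_j^λ,·)) over the set { x ∈ B_δ(x̄_i) : sgn(κ_i)ω_i^λ(x) > 0 }. -/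
open MeasureTheory Metric Real Filter Topology

noncomputable section

abbrev E2 := EuclideanSpace ℝ (Fin 2)

/-- Polar coordinates express the integral over a closed disc through circle averages. -/
theorem setIntegral_closedBall_eq_circleAverage {F : ℂ → ℝ} (hFm : Measurable F) {y : ℂ} {r : ℝ}
    (hF : IntegrableOn F (closedBall y r)) :
    ∫ u in closedBall y r, F u = ∫ ρ in Set.Ioc 0 r, ρ * (2 * π * circleAverage F y ρ) := by
  set g : ℂ → ℝ := (closedBall (0 : ℂ) r).indicator fun u => F (y + u) with hg
  have hgm : Measurable g :=
    (hFm.comp (measurable_const_add y)).indicator measurableSet_closedBall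
  have hg' : g = fun u => (closedBall y r).indicator F (y + u) := by
    ext u
    simp [hg, Set.indicator]
  have hgi : Integrable g := by
    rw [hg']
    exact (hF.integrable_indicator measurableSet_closedBall).comp_add_left y
  have hint : ∫ u in closedBall y r, F u = ∫ u, g u := by
    rw [hg', integral_add_left_eq_self ((closedBall y r).indicator F) y,
      integral_indicator measurableSet_closedBall]
  have hsymm : Continuous fun p : ℝ × ℝ => Complex.polarCoord.symm p := by
    simp only [Complex.polarCoord_symm_apply]
    fun_prop
  have hpm : Measurable fun p : ℝ × ℝ => p.1 • g (Complex.polarCoord.symm p) :=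
    measurable_fst.smul (hgm.comp hsymm.measurable)
  have hpi : IntegrableOn (fun p : ℝ × ℝ => p.1 • g (Complex.polarCoord.symm p))
      (Set.Ioi (0 : ℝ) ×ˢ Set.Ioo (-π) π) := by
    refine ⟨hpm.aestronglyMeasurable, ?_⟩
    have h1 := Complex.lintegral_comp_polarCoord_symm fun u => ‖g u‖ₑ
    have h2 : ∫⁻ p in polarCoord.target, ‖p.1 • g (Complex.polarCoord.symm p)‖ₑ < ⊤ := by
      refine lt_of_le_of_lt (le_of_eq ?_) (h1.trans_lt hgi.2)
      refine setLIntegral_congr_fun polarCoord.open_target.measurableSet fun p hp => ?_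
      have : 0 < p.1 := hp.1
      simp only [smul_eq_mul]
      rw [enorm_mul, Real.enorm_of_nonneg this.le]
    exact h2
  rw [hint, ← Complex.integral_comp_polarCoord_symm, polarCoord_target, Measure.volume_eq_prod,
    setIntegral_prod _ hpi, ← Set.Ioi_inter_Iic, ← setIntegral_indicator measurableSet_Iic]
  refine setIntegral_congr_fun measurableSet_Ioi fun ρ (hρ : 0 < ρ) => ?_
  simp only [smul_eq_mul]
  rw [integral_const_mul]
  by_cases hρr : ρ ≤ r
  · rw [Set.indicator_of_mem (Set.mem_Iic.2 hρr), ← integral_Ioc_eq_integral_Ioo,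
      ← intervalIntegral.integral_of_le (by linarith [pi_pos])]
    congr 1
    have hper : Function.Periodic (fun θ => F (circleMap y ρ θ)) (2 * π) :=
      (periodic_circleMap y ρ).comp F
    have h2 := hper.intervalIntegral_add_eq 0 (-π)
    rw [zero_add, show -π + 2 * π = π by ring] at h2
    rw [circleAverage, smul_eq_mul, ← mul_assoc, mul_inv_cancel₀ (by positivity), one_mul, h2]
    refine intervalIntegral.integral_congr fun θ _ => ?_
    have hmem : (Complex.polarCoord.symm (ρ, θ) : ℂ) ∈ closedBall (0 : ℂ) r := by
      rw [mem_closedBall_zero_iff, Complex.norm_polarCoord_symm, abs_of_pos hρ]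
      exact hρr
    rw [hg, Set.indicator_of_mem hmem]
    simp only [circleMap, Complex.polarCoord_symm_apply,
      Complex.exp_mul_I, Complex.ofReal_cos, Complex.ofReal_sin]
  · rw [Set.indicator_of_notMem (by simpa using hρr)]
    have : ∀ θ, g (Complex.polarCoord.symm (ρ, θ)) = 0 := fun θ => by
      refine Set.indicator_of_notMem ?_ _
      rw [mem_closedBall_zero_iff, Complex.norm_polarCoord_symm, abs_of_pos hρ]
      exact hρr
    simp only [this, mul_zero, integral_zero]

/-- The circle average of `log ‖· - w‖` exceeds the value at the centre by a truncated logarithm. -/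
theorem circleAverage_log_norm_sub_eq_add_posLog {y w : ℂ} (hw : y ≠ w) {ρ : ℝ} (hρ : 0 < ρ) :
    circleAverage (log ‖· - w‖) y ρ = log ‖y - w‖ + log⁺ (ρ / ‖y - w‖) := by
  have hd : 0 < ‖y - w‖ := norm_pos_iff.2 (sub_ne_zero.2 hw)
  rw [circleAverage_log_norm_sub_const_eq_log_radius_add_posLog hρ.ne']
  have h1 := posLog_sub_posLog_inv (x := ρ⁻¹ * ‖y - w‖)
  rw [log_mul (by positivity) hd.ne', log_inv, mul_inv, inv_inv, ← div_eq_mul_inv] at h1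
  linarith

/-- The deficit of the mean value property for the logarithmic kernel with pole at distance `d`
from the centre of a disc of radius `r`. -/
def logDeficit (r d : ℝ) : ℝ := ∫ ρ in Set.Ioc 0 r, ρ * log⁺ (ρ / d)

theorem logDeficit_nonneg (r d : ℝ) : 0 ≤ logDeficit r d :=
  setIntegral_nonneg measurableSet_Ioc fun _ hρ => mul_nonneg hρ.1.le posLog_nonneg

theorem logDeficit_eq_zero {r d : ℝ} (hd : 0 < d) (hrd : r ≤ d) : logDeficit r d = 0 := by
  refine setIntegral_eq_zero_of_forall_eq_zero fun ρ hρ => ?_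
  rw [(posLog_eq_zero_iff _).2, mul_zero]
  rw [abs_of_nonneg (div_nonneg hρ.1.le hd.le), div_le_one hd]
  exact hρ.2.trans hrd

theorem integrableOn_mul_posLog (r d : ℝ) :
    IntegrableOn (fun ρ => ρ * log⁺ (ρ / d)) (Set.Ioc 0 r) :=
  (Continuous.integrableOn_Icc (by fun_prop)).mono_set Set.Ioc_subset_Icc_self

theorem logDeficit_le {r d : ℝ} (hr : 0 ≤ r) (hd : 0 < d) :
    logDeficit r d ≤ r ^ 2 * log⁺ (r / d) := by
  have h1 : logDeficit r d ≤ ∫ _ρ in Set.Ioc 0 r, r * log⁺ (r / d) := by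
    refine setIntegral_mono_on (integrableOn_mul_posLog r d) (integrableOn_const (by simp))
      measurableSet_Ioc
      fun ρ hρ => ?_
    refine mul_le_mul hρ.2 ?_ posLog_nonneg hr
    refine monotoneOn_posLog (Set.mem_Ici.2 (div_nonneg hρ.1.le hd.le))
      (Set.mem_Ici.2 (div_nonneg hr hd.le)) ?_
    gcongr
    exact hρ.2
  refine h1.trans (le_of_eq ?_)
  simp [hr]
  ring

theorem le_logDeficit {r d : ℝ} (hr : 0 < r) (hd : 0 < d) (hdr : d ≤ r / 4) :
    log 2 / 4 * r ^ 2 ≤ logDeficit r d := by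
  have hsub : Set.Ioc (r / 2) r ⊆ Set.Ioc 0 r := Set.Ioc_subset_Ioc_left (by positivity)
  have h1 : ∫ _ρ in Set.Ioc (r / 2) r, r / 2 * log 2 ≤
      ∫ ρ in Set.Ioc (r / 2) r, ρ * log⁺ (ρ / d) := by
    refine setIntegral_mono_on (integrableOn_const (by simp))
      ((integrableOn_mul_posLog r d).mono_set hsub)
      measurableSet_Ioc fun ρ hρ => ?_
    have h2 : 2 ≤ ρ / d := by
      rw [le_div_iff₀ hd]
      linarith [hρ.1]
    rw [posLog_eq_log (by rw [abs_of_nonneg (by linarith)]; linarith)]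
    have h3 : log 2 ≤ log (ρ / d) := log_le_log (by norm_num) h2
    exact mul_le_mul hρ.1.le h3 (log_nonneg (by norm_num)) (by linarith [hρ.1])
  have h2 : ∫ ρ in Set.Ioc (r / 2) r, ρ * log⁺ (ρ / d) ≤ logDeficit r d := by
    refine setIntegral_mono_set (integrableOn_mul_posLog r d) ?_ hsub.eventuallyLE
    exact (ae_restrict_iff' measurableSet_Ioc).2
      (.of_forall fun ρ hρ => mul_nonneg hρ.1.le posLog_nonneg)
  refine le_trans (le_of_eq ?_) (h1.trans h2)
  simp [show r / 2 ≤ r by linarith]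
  ring

open InnerProductSpace in
/-- Mean value deficit of a logarithmic kernel with harmonic regular part. -/
theorem setIntegral_closedBall_log_sub_harmonic {k H : ℂ → ℝ} (hkm : Measurable k) {y w : ℂ}
    (hyw : y ≠ w) {r : ℝ} (hr : 0 < r) (hki : IntegrableOn k (closedBall y r))
    (hk : ∀ u ∈ closedBall y r, k u = -(1 / (2 * π)) * log ‖u - w‖ - H u)
    (hH : HarmonicOnNhd H (closedBall y r)) :
    ∫ u in closedBall y r, (k y - k u) = logDeficit r ‖y - w‖ := by
  have hy : y ∈ closedBall y r := mem_closedBall_self hr.le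
  have h1 := setIntegral_closedBall_eq_circleAverage (F := fun u => k y - k u)
    (hkm.const_sub _) ((integrableOn_const measure_closedBall_lt_top.ne).sub hki)
  rw [h1]
  refine setIntegral_congr_fun measurableSet_Ioc fun ρ hρ => ?_
  have hsub : closedBall y |ρ| ⊆ closedBall y r := by
    rw [abs_of_pos hρ.1]
    exact closedBall_subset_closedBall hρ.2
  have hHρ : HarmonicOnNhd H (closedBall y |ρ|) := hH.mono hsub
  have hHi : CircleIntegrable H y ρ :=
    (hHρ.continuousOn.mono sphere_subset_closedBall).circleIntegrable'
  have hLi : CircleIntegrable (log ‖· - w‖) y ρ :=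
    MeromorphicOn.circleIntegrable_log_norm (fun _ _ ↦ by fun_prop)
  have h2 : circleAverage (fun u => k y - k u) y ρ =
      circleAverage ((fun _ => k y) + ((1 / (2 * π)) • (log ‖· - w‖) + H)) y ρ := by
    refine circleAverage_congr_sphere fun u hu => ?_
    simp only [Pi.add_apply, Pi.smul_apply, smul_eq_mul]
    rw [hk u (hsub (sphere_subset_closedBall hu))]
    ring
  have h3 : CircleIntegrable ((1 / (2 * π)) • (log ‖· - w‖)) y ρ := hLi.const_smul
  rw [h2, circleAverage_add (circleIntegrable_const _ _ _) (h3.add hHi),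
    circleAverage_add h3 hHi, circleAverage_const, circleAverage_smul,
    circleAverage_log_norm_sub_eq_add_posLog hyw hρ.1, hHρ.circleAverage_eq, hk y hy]
  simp only [smul_eq_mul]
  field_simp
  ring

open InnerProductSpace in
/-- A planar function with vanishing Laplacian is harmonic in the complex coordinate. -/
theorem harmonicOnNhd_comp_orthonormalBasisOneI {H : E2 → ℝ} {D : Set E2} (hD : IsOpen D)
    (hc : ContDiffOn ℝ 2 H D)
    (hl : ∀ x ∈ D, ∑ i : Fin 2, iteratedFDerivWithin ℝ 2 H D x
      ![EuclideanSpace.single i 1, EuclideanSpace.single i 1] = 0) :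
    HarmonicOnNhd (H ∘ Complex.orthonormalBasisOneI.repr)
      (Complex.orthonormalBasisOneI.repr ⁻¹' D) := by
  set e := Complex.orthonormalBasisOneI.repr with he
  have hΔ : ∀ z ∈ e ⁻¹' D, Laplacian.laplacian (H ∘ e) z = 0 := fun z hz => by
    rw [laplacian_eq_iteratedFDeriv_orthonormalBasis _ Complex.orthonormalBasisOneI]
    rw [← hl (e z) hz]
    refine Finset.sum_congr rfl fun i _ => ?_
    have h1 : iteratedFDerivWithin ℝ 2 (H ∘ e) (e ⁻¹' D) z =
        (iteratedFDerivWithin ℝ 2 H D (e z)).compContinuousLinearMap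
          fun _ => (e.toContinuousLinearEquiv : ℂ →L[ℝ] E2) :=
      e.toContinuousLinearEquiv.iteratedFDerivWithin_comp_right H hD.uniqueDiffOn hz 2
    rw [iteratedFDerivWithin_of_isOpen 2 (hD.preimage e.continuous) hz] at h1
    rw [h1, ContinuousMultilinearMap.compContinuousLinearMap_apply]
    congr 1
    have hb : e (Complex.orthonormalBasisOneI i) = EuclideanSpace.single i 1 :=
      Complex.orthonormalBasisOneI.repr_self i
    ext j : 1
    fin_cases j <;> exact hb
  intro z hz
  refine ⟨(hc.contDiffAt (hD.mem_nhds hz)).comp z e.contDiff.contDiffAt, ?_⟩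
  filter_upwards [(hD.preimage e.continuous).mem_nhds hz] with u hu using hΔ u hu

/-- Mean value deficit of a planar Green-type kernel. -/
theorem setIntegral_closedBall_greenKernel {k H : E2 → ℝ} (hkm : Measurable k) {D : Set E2}
    (hD : IsOpen D) (hc : ContDiffOn ℝ 2 H D)
    (hl : ∀ x ∈ D, ∑ i : Fin 2, iteratedFDerivWithin ℝ 2 H D x
      ![EuclideanSpace.single i 1, EuclideanSpace.single i 1] = 0)
    {y w : E2} (hyw : y ≠ w) {r : ℝ} (hr : 0 < r) (hyD : closedBall y r ⊆ D)
    (hki : IntegrableOn k (closedBall y r))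
    (hk : ∀ u ∈ closedBall y r, k u = (1 / (2 * π)) * log (1 / dist u w) - H u) :
    ∫ u in closedBall y r, (k y - k u) = logDeficit r (dist y w) := by
  set e := Complex.orthonormalBasisOneI.repr with he
  have hmp : MeasurePreserving e := e.measurePreserving
  have hme : MeasurableEmbedding e := e.toHomeomorph.measurableEmbedding
  have hpre : e ⁻¹' closedBall y r = closedBall (e.symm y) r := by
    ext z
    rw [Set.mem_preimage, mem_closedBall, mem_closedBall, ← e.dist_map z, e.apply_symm_apply]
  have hnorm : ∀ u w : ℂ, dist (e u) (e w) = ‖u - w‖ := fun u w => by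
    rw [e.dist_map, dist_eq_norm]
  have h1 := setIntegral_closedBall_log_sub_harmonic (k := k ∘ e) (H := H ∘ e)
    (y := e.symm y) (w := e.symm w) (hkm.comp e.continuous.measurable)
    (fun h => hyw (e.symm.injective h)) hr
    (by rw [← hpre]; exact (hmp.integrableOn_comp_preimage hme).2 hki)
    (fun u hu => by
      have hu' : e u ∈ closedBall y r := by rwa [← hpre] at hu
      rw [Function.comp_apply, hk _ hu', Function.comp_apply, ← hnorm, e.apply_symm_apply,
        one_div (dist _ _), log_inv]
      ring)
    ((harmonicOnNhd_comp_orthonormalBasisOneI hD hc hl).mono (by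
      rw [← hpre]; exact Set.preimage_mono hyD))
  rw [← hnorm, e.apply_symm_apply, e.apply_symm_apply, ← hpre] at h1
  rw [← h1, ← hmp.setIntegral_preimage_emb hme]
  simp

theorem integrable_indicator_ball_abs_log_norm (R : ℝ) :
    Integrable ((ball (0 : E2) R).indicator fun u => |log ‖u‖|) := by
  rw [integrable_indicator_iff measurableSet_ball,
    integrableOn_fun_norm_addHaar volume (f := fun t => |log t|)]
  refine (Continuous.integrableOn_Icc (f := fun t : ℝ => |t * log t|) (a := 0) (b := R)
    continuous_mul_log.abs).mono_set Set.Ioo_subset_Icc_self |>.congr_fun (fun t ht => ?_)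
    measurableSet_Ioo
  simp [abs_mul, abs_of_pos ht.1]

theorem integrable_posLog_inv_norm : Integrable fun u : E2 => log⁺ (1 / ‖u‖) := by
  refine (integrable_indicator_ball_abs_log_norm 1).mono ?_ (.of_forall fun u => ?_)
  · exact (continuous_posLog.measurable.comp (measurable_norm.const_div 1)).aestronglyMeasurable
  · by_cases hu : ‖u‖ < 1
    · rw [Set.indicator_of_mem (mem_ball_zero_iff.2 hu), norm_of_nonneg posLog_nonneg,
        norm_of_nonneg (abs_nonneg _), posLog_apply, one_div, log_inv]
      exact max_le (abs_nonneg _) (neg_le_abs _)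
    · rw [(posLog_eq_zero_iff _).2, norm_zero]
      · exact norm_nonneg _
      · rw [abs_of_nonneg (by positivity)]
        exact div_le_one_of_le₀ (not_lt.1 hu) (norm_nonneg _)

/-- Scaling of the integral of the truncated logarithm. -/
theorem integral_posLog_div_dist (y : E2) {r : ℝ} (hr : 0 < r) :
    (Integrable fun w : E2 => log⁺ (r / dist y w)) ∧
      ∫ w : E2, log⁺ (r / dist y w) = r ^ 2 * ∫ u : E2, log⁺ (1 / ‖u‖) := by
  have h1 : (fun w : E2 => log⁺ (r / dist y w)) =
      fun w => (fun v : E2 => log⁺ (1 / ‖r⁻¹ • v‖)) (y - w) := by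
    ext w
    simp only [dist_eq_norm, norm_smul, norm_inv]
    rw [norm_of_nonneg hr.le]
    congr 1
    field_simp
  rw [h1]
  refine ⟨((integrable_comp_smul_iff volume (fun u : E2 => log⁺ (1 / ‖u‖))
    (inv_ne_zero hr.ne')).2 integrable_posLog_inv_norm).comp_sub_left y, ?_⟩
  rw [integral_sub_left_eq_self (fun v : E2 => log⁺ (1 / ‖r⁻¹ • v‖)) volume y,
    Measure.integral_comp_smul volume (fun u : E2 => log⁺ (1 / ‖u‖))]
  simp

theorem volume_real_closedBall (x : E2) {r : ℝ} (hr : 0 ≤ r) :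
    volume.real (closedBall x r) = π * r ^ 2 := by
  rw [Measure.real, EuclideanSpace.volume_closedBall_fin_two]
  simp [hr, pi_pos.le]
  ring

theorem abs_setIntegral_sub_const_le {Φ : E2 → ℝ} {S B K : Set E2} {c T : ℝ}
    (hB : MeasurableSet B) (hBK : B ⊆ K) (hK : volume K ≠ ⊤)
    (hSc : ∀ x ∈ S, Φ x = c) (hT : ∀ x ∈ K, |Φ x - c| ≤ T) (hT0 : 0 ≤ T) :
    |∫ u in B, (Φ u - c)| ≤ T * volume.real (K \ S) := by
  have h1 : ∫ u in B, (Φ u - c) = ∫ u in B \ S, (Φ u - c) := by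
    refine (setIntegral_eq_of_subset_of_forall_sdiff_eq_zero hB Set.sdiff_subset ?_)
    rintro x ⟨hx, hx'⟩
    rw [hSc x (by_contra fun h => hx' ⟨hx, h⟩), sub_self]
  have h2 : volume (K \ S) ≠ ⊤ := measure_ne_top_of_subset Set.sdiff_subset hK
  have h3 : B \ S ⊆ K \ S := Set.sdiff_subset_sdiff_left hBK
  rw [h1]
  calc |∫ u in B \ S, (Φ u - c)| ≤ T * volume.real (B \ S) :=
        norm_setIntegral_le_of_norm_le_const (f := fun u => Φ u - c)
          (measure_ne_top_of_subset h3 h2).lt_top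
          fun x hx => hT x (h3 hx).1
    _ ≤ T * volume.real (K \ S) := by
        gcongr

theorem exists_forall_volume_sdiff_le {S : Set E2} (hS : MeasurableSet S) {x₀ : E2}
    (h : Tendsto (fun r => volume (S ∩ closedBall x₀ r) / volume (closedBall x₀ r))
      (𝓝[>] 0) (𝓝 1)) {η : ℝ} (hη : 0 < η) :
    ∃ R > 0, ∀ r, 0 < r → r < R → volume.real (closedBall x₀ r \ S) ≤ η * (π * r ^ 2) := by
  have h1 := (ENNReal.continuousAt_toReal ENNReal.one_ne_top).tendsto.comp h
  rw [ENNReal.toReal_one] at h1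
  have h2 := h1.eventually (lt_mem_nhds (show 1 - η < 1 by linarith))
  obtain ⟨R, hR, hR'⟩ := mem_nhdsGT_iff_exists_Ioo_subset.1 h2
  refine ⟨R, hR, fun r hr hrR => ?_⟩
  have h3 : 1 - η < (volume (S ∩ closedBall x₀ r) / volume (closedBall x₀ r)).toReal :=
    hR' ⟨hr, hrR⟩
  rw [ENNReal.toReal_div, ← Measure.real, ← Measure.real, volume_real_closedBall x₀ hr.le,
    lt_div_iff₀ (by positivity), Set.inter_comm] at h3
  have h4 := measureReal_inter_add_sdiff (μ := volume) (s := closedBall x₀ r) hS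
    (measure_closedBall_lt_top.ne)
  rw [volume_real_closedBall x₀ hr.le] at h4
  linarith

/-- If `Φ` has bounded mean value deficits of order `r ^ 4` which dominate local integrals of
`f ≥ 0`, then `f` vanishes almost everywhere on each level set of `Φ`. -/
theorem ae_eq_zero_on_levelSet {Φ f : E2 → ℝ} {U : Set E2} (hU : IsOpen U) (hΦm : Measurable Φ)
    {M C a : ℝ} (hΦb : ∀ x ∈ U, |Φ x| ≤ M) (hfm : Measurable f) (hf0 : ∀ᵐ x, x ∈ U → 0 ≤ f x)
    (hfi : IntegrableOn f U) (ha : 0 < a)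
    (hup : ∀ y r, 0 < r → closedBall y r ⊆ U → |∫ u in closedBall y r, (Φ y - Φ u)| ≤ C * r ^ 4)
    (hlow : ∀ y r, 0 < r → closedBall y r ⊆ U →
      a * r ^ 2 * ∫ w in closedBall y (r / 4), f w ≤ ∫ u in closedBall y r, (Φ y - Φ u))
    (c : ℝ) : ∀ᵐ x, x ∈ U → Φ x = c → f x = 0 := by
  have hΦi : ∀ y r, closedBall y r ⊆ U → IntegrableOn Φ (closedBall y r) := fun y r hyr =>
    Measure.integrableOn_of_bounded measure_closedBall_lt_top.ne hΦm.aestronglyMeasurable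
      ((ae_restrict_iff' measurableSet_closedBall).2 (.of_forall fun x hx => hΦb x (hyr hx)))
  have hnull : ∀ n : ℕ, volume {x | x ∈ U ∧ Φ x = c ∧ 1 / ((n : ℝ) + 1) ≤ f x} = 0 := by
    intro n
    set ε : ℝ := 1 / ((n : ℝ) + 1) with hε
    have hε0 : 0 < ε := by positivity
    set S := {x | x ∈ U ∧ Φ x = c ∧ ε ≤ f x} with hSdef
    have hS : MeasurableSet S :=
      hU.measurableSet.inter ((hΦm (measurableSet_singleton c)).inter (hfm measurableSet_Ici))
    by_contra hne
    have : NeBot (ae (volume.restrict S)) := by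
      rwa [ae_neBot, Ne, Measure.restrict_eq_zero]
    obtain ⟨x₀, hdens, hx₀⟩ := ((Besicovitch.ae_tendsto_measure_inter_div volume S).and
      (ae_restrict_mem hS)).exists
    have hSc : ∀ x ∈ S, Φ x = c := fun x hx => hx.2.1
    obtain ⟨R₁, hR₁, hR₁'⟩ := Metric.isOpen_iff.1 hU x₀ hx₀.1
    obtain ⟨R₂, hR₂, hR₂'⟩ := exists_forall_volume_sdiff_le hS hdens (η := 1 / 32) (by norm_num)
    set r₀ := min R₁ R₂ / 2 with hr₀
    have hr₀pos : 0 < r₀ := by positivity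
    have hr₀1 : r₀ < R₁ := (half_lt_self (by positivity)).trans_le (min_le_left _ _)
    have hr₀2 : r₀ < R₂ := (half_lt_self (by positivity)).trans_le (min_le_right _ _)
    set ρ : ℕ → ℝ := fun k => r₀ / 2 ^ k with hρ
    have hρpos : ∀ k, 0 < ρ k := fun k => by positivity
    have hρle : ∀ k, ρ k ≤ r₀ := fun k => div_le_self hr₀pos.le (one_le_pow₀ (by norm_num))
    have hρsucc : ∀ k, ρ k = 2 * ρ (k + 1) := fun k => by
      simp only [hρ, pow_succ]
      field_simp
    have hρU : ∀ k, closedBall x₀ (ρ k) ⊆ U := fun k =>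
      (closedBall_subset_ball ((hρle k).trans_lt hr₀1)).trans hR₁'
    have hM : 0 ≤ M := (abs_nonneg _).trans (hΦb x₀ hx₀.1)
    set A := max (2 * C / π) (2 * M / r₀ ^ 2) with hA
    have hA0 : 0 ≤ A := le_max_of_le_right (by positivity)
    have hgrowth : ∀ k, ∀ y ∈ closedBall x₀ (ρ k), |Φ y - c| ≤ A * ρ k ^ 2 := by
      intro k
      induction k with
      | zero =>
        intro y hy
        have h1 : 2 * M ≤ A * r₀ ^ 2 := by
          rw [← div_le_iff₀ (by positivity)]
          exact le_max_right _ _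
        have h2 : |c| ≤ M := hSc x₀ hx₀ ▸ hΦb x₀ hx₀.1
        have h3 := hΦb y (hρU 0 hy)
        have h4 := abs_sub (Φ y) c
        simp only [hρ, pow_zero, div_one]
        linarith
      | succ k ih =>
        intro y hy
        set r := ρ (k + 1) with hr
        have hrpos : 0 < r := hρpos _
        have h2r : ρ k = 2 * r := hρsucc k
        have hsub : closedBall y r ⊆ closedBall x₀ (ρ k) := by
          refine closedBall_subset_closedBall' ?_
          rw [h2r]
          linarith [mem_closedBall.1 hy]
        have hyU := hsub.trans (hρU k)
        have h1 := abs_setIntegral_sub_const_le measurableSet_closedBall hsub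
          measure_closedBall_lt_top.ne hSc ih (by positivity)
        have h2 := hR₂' (ρ k) (hρpos k) ((hρle k).trans_lt hr₀2)
        have h3 := hup y r hrpos hyU
        have h4 : π * r ^ 2 * (Φ y - c) =
            (∫ u in closedBall y r, (Φ y - Φ u)) + ∫ u in closedBall y r, (Φ u - c) := by
          have hc : ∀ t : ℝ, IntegrableOn (fun _ => t) (closedBall y r) :=
            fun t => integrableOn_const measure_closedBall_lt_top.ne
          rw [← integral_add (f := fun u => Φ y - Φ u) (g := fun u => Φ u - c)
            ((hc _).sub (hΦi y r hyU)) ((hΦi y r hyU).sub (hc _))]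
          simp [volume_real_closedBall y hrpos.le]
        have h5 : π * r ^ 2 * |Φ y - c| ≤
            C * r ^ 4 + A * ρ k ^ 2 * (1 / 32 * (π * ρ k ^ 2)) := by
          rw [← abs_of_pos (show 0 < π * r ^ 2 by positivity), ← abs_mul, h4]
          refine (abs_add_le _ _).trans (add_le_add h3 (h1.trans ?_))
          gcongr
        have h6 : C ≤ A / 2 * π := by
          have : 2 * C / π ≤ A := le_max_left _ _
          rw [div_le_iff₀ pi_pos] at this
          linarith
        have h7 : C * r ^ 4 ≤ A / 2 * π * r ^ 4 := by gcongr
        rw [h2r] at h5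
        have h8 : π * r ^ 2 * |Φ y - c| ≤ π * r ^ 2 * (A * r ^ 2) := by nlinarith
        exact le_of_mul_le_mul_left h8 (by positivity)
    set η := a * ε / (64 * (A + 1)) with hη
    obtain ⟨R₃, hR₃, hR₃'⟩ := exists_forall_volume_sdiff_le hS hdens (η := η) (by positivity)
    obtain ⟨k, hk⟩ : ∃ k, ρ k < R₃ := by
      have : Tendsto ρ atTop (𝓝 0) := by
        have := (tendsto_pow_atTop_nhds_zero_of_lt_one (r := (1 / 2 : ℝ)) (by norm_num)
          (by norm_num)).const_mul r₀
        simpa [hρ, div_eq_mul_inv] using this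
      exact (this.eventually (gt_mem_nhds hR₃)).exists
    set r := ρ k with hr
    have hrpos : 0 < r := hρpos k
    have h1 := abs_setIntegral_sub_const_le measurableSet_closedBall
      (subset_refl (closedBall x₀ r)) measure_closedBall_lt_top.ne hSc (hgrowth k) (by positivity)
    have h2 := hR₃' r hrpos hk
    have h3 := hlow x₀ r hrpos (hρU k)
    have h4 : ∫ u in closedBall x₀ r, (Φ x₀ - Φ u) = -∫ u in closedBall x₀ r, (Φ u - c) := by
      rw [← integral_neg, hSc x₀ hx₀]
      simp
    have hsub : closedBall x₀ (r / 4) ⊆ U :=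
      (closedBall_subset_closedBall (by linarith)).trans (hρU k)
    have h5 : ε * volume.real (closedBall x₀ (r / 4) ∩ S) ≤ ∫ w in closedBall x₀ (r / 4), f w := by
      have hm := measurableSet_closedBall (x := x₀) (ε := r / 4)
      have h6 : ∫ w in closedBall x₀ (r / 4) ∩ S, ε ≤ ∫ w in closedBall x₀ (r / 4) ∩ S, f w :=
        setIntegral_mono_on (integrableOn_const
          (measure_ne_top_of_subset Set.inter_subset_left measure_closedBall_lt_top.ne))
          (hfi.mono_set (Set.inter_subset_left.trans hsub)) (hm.inter hS) fun x hx => hx.2.2.2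
      have h7 : ∫ w in closedBall x₀ (r / 4) ∩ S, f w ≤ ∫ w in closedBall x₀ (r / 4), f w := by
        refine setIntegral_mono_set (hfi.mono_set hsub) ?_ Set.inter_subset_left.eventuallyLE
        rw [EventuallyLE, ae_restrict_iff' hm]
        filter_upwards [hf0] with x hx hxB using hx (hsub hxB)
      rw [setIntegral_const, smul_eq_mul, mul_comm] at h6
      exact h6.trans h7
    have h6 := hR₂' (r / 4) (by positivity) (by linarith [hρle k])
    have h7 := measureReal_inter_add_sdiff (μ := volume) (s := closedBall x₀ (r / 4)) hS
      (measure_closedBall_lt_top.ne)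
    rw [volume_real_closedBall x₀ (by positivity)] at h7
    have h8 : π * r ^ 2 / 32 ≤ volume.real (closedBall x₀ (r / 4) ∩ S) := by
      nlinarith [show 0 < π * r ^ 2 by positivity]
    have h9 : a * r ^ 2 * (ε * (π * r ^ 2 / 32)) ≤ A * r ^ 2 * (η * (π * r ^ 2)) :=
      calc a * r ^ 2 * (ε * (π * r ^ 2 / 32))
          ≤ a * r ^ 2 * ∫ w in closedBall x₀ (r / 4), f w := by
            gcongr
            exact le_trans (by gcongr) h5
        _ ≤ |∫ u in closedBall x₀ r, (Φ u - c)| := by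
            rw [h4] at h3
            exact h3.trans (neg_le_abs _)
        _ ≤ A * r ^ 2 * (η * (π * r ^ 2)) := h1.trans (by gcongr)
    have h10 : a * ε / 32 ≤ A * η := by
      have : 0 < π * r ^ 4 := by positivity
      refine le_of_mul_le_mul_right ?_ this
      linarith
    have h11 : (A + 1) * η = a * ε / 64 := by
      rw [hη]
      field_simp
    have h12 : 0 < a * ε := by positivity
    have h13 : 0 < η := by positivity
    linarith
  filter_upwards [hf0, (measure_eq_zero_iff_ae_notMem.1 (measure_iUnion_null hnull))] with x hx0 hx
    hxU hxc
  by_contra hfx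
  obtain ⟨n, hn⟩ := exists_nat_one_div_lt (lt_of_le_of_ne (hx0 hxU) (Ne.symm hfx))
  exact hx (Set.mem_iUnion.2 ⟨n, hxU, hxc, hn.le⟩)

/-- Bathtub principle: a function optimal for a linear functional among densities with values in
`[0, lam]`, prescribed mass and support in `B`, and vanishing on the level sets of the weight, is
`lam` times the indicator of a superlevel set of the weight. -/
theorem ae_eq_ite_essInf_lt_of_optimal {φ v : E2 → ℝ} {B : Set E2} {lam M : ℝ}
    (hB : MeasurableSet B) (hBf : volume B ≠ ⊤) (hφm : Measurable φ)
    (hφb : ∀ x ∈ B, |φ x| ≤ M) (hvm : Measurable v) (hv : ∀ᵐ x, 0 ≤ v x ∧ v x ≤ lam)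
    (hvpos : 0 < ∫ x in B, v x)
    (hopt : ∀ η : E2 → ℝ, Measurable η → (∀ x, x ∉ B → η x = 0) → ∫ x, η x = 0 →
      (∀ᵐ x, 0 ≤ v x + η x ∧ v x + η x ≤ lam) → ∫ x, η x * φ x ≤ 0)
    (hlev : ∀ c, ∀ᵐ x, x ∈ B → φ x = c → v x = 0) :
    ∀ᵐ x, x ∈ B →
      v x = if essInf φ (volume.restrict {x ∈ B | 0 < v x}) < φ x then lam else 0 := by
  set W := {x ∈ B | 0 < v x} with hWdef
  have hW : MeasurableSet W := hB.inter (measurableSet_lt measurable_const hvm)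
  set c := essInf φ (volume.restrict W) with hc
  have hvi : ∀ T ⊆ B, IntegrableOn v T := fun T hT =>
    Measure.integrableOn_of_bounded (M := lam) (measure_ne_top_of_subset hT hBf)
      hvm.aestronglyMeasurable (ae_restrict_of_ae (hv.mono fun x hx => by
        rw [norm_of_nonneg hx.1]; exact hx.2))
  have hWne : volume W ≠ 0 := by
    intro h0
    refine hvpos.ne' (setIntegral_eq_zero_of_ae_eq_zero ?_)
    filter_upwards [measure_eq_zero_iff_ae_notMem.1 h0, hv] with x hx hx' hxB
    exact le_antisymm (not_lt.1 fun h => hx ⟨hxB, h⟩) hx'.1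
  have hWne' : NeBot (ae (volume.restrict W)) := by
    rwa [ae_neBot, Ne, Measure.restrict_eq_zero]
  have hφW : ∀ᵐ x ∂volume.restrict W, |φ x| ≤ M :=
    (ae_restrict_iff' hW).2 (.of_forall fun x hx => hφb x hx.1)
  have hlow : ∀ᵐ x ∂volume.restrict W, c ≤ φ x :=
    ae_essInf_le ⟨-M, eventually_map.2 (hφW.mono fun x hx => (abs_le.1 hx).1)⟩
  rw [ae_restrict_iff' hW] at hlow
  have hcob : IsCoboundedUnder (· ≥ ·) (ae (volume.restrict W)) φ :=
    IsBoundedUnder.isCoboundedUnder_ge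
      ⟨M, eventually_map.2 (hφW.mono fun x hx => (abs_le.1 hx).2)⟩
  have hnear : ∀ a, c < a → volume {x ∈ W | φ x < a} ≠ 0 := by
    intro a ha h0
    refine ha.not_ge (le_liminf_of_le hcob ?_)
    rw [ae_restrict_iff' hW]
    filter_upwards [measure_eq_zero_iff_ae_notMem.1 h0] with x hx hxW
    exact not_lt.1 fun h => hx ⟨hxW, h⟩
  have habove : ∀ a, c < a → ∀ᵐ x, x ∈ B → a < φ x → lam ≤ v x := by
    intro a ha
    set T₁ := {x ∈ W | φ x < a} with hT₁def
    set T₀ := {x | x ∈ B ∧ a < φ x ∧ v x < lam} with hT₀def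
    have hT₁ : MeasurableSet T₁ := hW.inter (measurableSet_lt hφm measurable_const)
    have hT₀ : MeasurableSet T₀ :=
      hB.inter ((measurableSet_lt measurable_const hφm).inter
        (measurableSet_lt hvm measurable_const))
    have hT₁B : T₁ ⊆ B := fun x hx => hx.1.1
    have hT₀B : T₀ ⊆ B := fun x hx => hx.1
    have hdisj : ∀ x ∈ T₀, x ∉ T₁ := fun x h0 h1 => lt_asymm h0.2.1 h1.2
    set I₁ := ∫ x in T₀, (lam - v x) with hI₁
    set I₂ := ∫ x in T₁, v x with hI₂
    have hI₁0 : 0 ≤ I₁ := setIntegral_nonneg hT₀ fun x hx => by linarith [hx.2.2]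
    have hI₂0 : 0 < I₂ := by
      rw [hI₂, setIntegral_pos_iff_support_of_nonneg_ae
        (ae_restrict_of_ae (hv.mono fun x hx => hx.1)) (hvi T₁ hT₁B)]
      refine (pos_iff_ne_zero.2 (hnear a ha)).trans_le (measure_mono fun x hx => ⟨?_, hx⟩)
      exact hx.1.2.ne'
    set m := I₁ + I₂ with hm
    have hm0 : 0 < m := by positivity
    set η : E2 → ℝ := fun x =>
      I₂ / m * T₀.indicator (fun x => lam - v x) x - I₁ / m * T₁.indicator v x with hη
    have hηm : Measurable η :=
      (((measurable_const.sub hvm).indicator hT₀).const_mul _).sub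
        ((hvm.indicator hT₁).const_mul _)
    have hi₀ : Integrable (T₀.indicator fun x => lam - v x) :=
      (integrable_indicator_iff hT₀).2
        ((integrableOn_const (measure_ne_top_of_subset hT₀B hBf)).sub (hvi T₀ hT₀B))
    have hi₁ : Integrable (T₁.indicator v) := (integrable_indicator_iff hT₁).2 (hvi T₁ hT₁B)
    have hηi : Integrable η := (hi₀.const_mul _).sub (hi₁.const_mul _)
    have hηB : ∀ x, x ∉ B → η x = 0 := fun x hx => by
      simp only [hη]
      rw [Set.indicator_of_notMem fun h => hx (hT₀B h),
        Set.indicator_of_notMem fun h => hx (hT₁B h)]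
      simp
    have hη0 : ∫ x, η x = 0 := by
      rw [hη, integral_sub (hi₀.const_mul _) (hi₁.const_mul _), integral_const_mul,
        integral_const_mul, integral_indicator hT₀, integral_indicator hT₁]
      ring
    have hηT₀ : ∀ x ∈ T₀, η x = I₂ / m * (lam - v x) := fun x hx => by
      simp only [hη]
      rw [Set.indicator_of_mem hx, Set.indicator_of_notMem (hdisj x hx)]
      simp
    have hηT₁ : ∀ x ∈ T₁, η x = -(I₁ / m * v x) := fun x hx => by
      simp only [hη]
      rw [Set.indicator_of_mem hx, Set.indicator_of_notMem fun h => hdisj x h hx]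
      simp
    have hηout : ∀ x, x ∉ T₀ → x ∉ T₁ → η x = 0 := fun x h0 h1 => by
      simp only [hη]
      rw [Set.indicator_of_notMem h0, Set.indicator_of_notMem h1]
      simp
    have hα0 : 0 < I₂ / m := by positivity
    have hα1 : I₂ / m ≤ 1 := div_le_one_of_le₀ (by linarith) hm0.le
    have hβ0 : 0 ≤ I₁ / m := by positivity
    have hβ1 : I₁ / m ≤ 1 := div_le_one_of_le₀ (by linarith) hm0.le
    have hadm : ∀ᵐ x, 0 ≤ v x + η x ∧ v x + η x ≤ lam := by
      filter_upwards [hv] with x hx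
      by_cases h0 : x ∈ T₀
      · rw [hηT₀ x h0]
        have h1 : 0 ≤ I₂ / m * (lam - v x) := mul_nonneg hα0.le (by linarith [hx.2])
        have h2 : I₂ / m * (lam - v x) ≤ 1 * (lam - v x) :=
          mul_le_mul_of_nonneg_right hα1 (by linarith [hx.2])
        constructor <;> linarith [hx.1]
      · by_cases h1 : x ∈ T₁
        · rw [hηT₁ x h1]
          have h1 : 0 ≤ I₁ / m * v x := mul_nonneg hβ0 hx.1
          have h2 : I₁ / m * v x ≤ 1 * v x := mul_le_mul_of_nonneg_right hβ1 hx.1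
          constructor <;> linarith [hx.2]
        · rw [hηout x h0 h1, add_zero]
          exact hx
    have hle := hopt η hηm hηB hη0 hadm
    have hηφ : Integrable fun x => η x * φ x := by
      have : (fun x => η x * φ x) = fun x => B.indicator φ x * η x := by
        ext x
        by_cases hx : x ∈ B
        · rw [Set.indicator_of_mem hx, mul_comm]
        · rw [hηB x hx]
          simp
      rw [this]
      refine hηi.bdd_mul (c := |M|) (hφm.indicator hB).aestronglyMeasurable (.of_forall fun x => ?_)
      by_cases hx : x ∈ B
      · rw [Set.indicator_of_mem hx]
        exact (hφb x hx).trans (le_abs_self M)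
      · rw [Set.indicator_of_notMem hx]
        simp
    have hgi : Integrable fun x => η x * (φ x - a) := by
      simp only [mul_sub]
      exact hηφ.sub (hηi.mul_const a)
    have hgint : ∫ x, η x * (φ x - a) ≤ 0 := by
      simp only [mul_sub]
      rw [integral_sub hηφ (hηi.mul_const a), integral_mul_const, hη0]
      linarith
    have hg0 : 0 ≤ᵐ[volume] fun x => η x * (φ x - a) := by
      filter_upwards [hv] with x hx
      by_cases h0 : x ∈ T₀
      · rw [hηT₀ x h0]
        exact mul_nonneg (mul_nonneg hα0.le (by linarith [hx.2])) (by linarith [h0.2.1])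
      · by_cases h1 : x ∈ T₁
        · rw [hηT₁ x h1]
          exact mul_nonneg_of_nonpos_of_nonpos (neg_nonpos.2 (mul_nonneg hβ0 hx.1))
            (by linarith [h1.2])
        · rw [hηout x h0 h1, zero_mul]
          rfl
    have hgae := (integral_eq_zero_iff_of_nonneg_ae hg0 hgi).1
      (le_antisymm hgint (integral_nonneg_of_ae hg0))
    filter_upwards [hgae] with x hx hxB hax
    by_contra hlt
    have hxT : x ∈ T₀ := ⟨hxB, hax, not_le.1 hlt⟩
    rw [hηT₀ x hxT] at hx
    have h1 : 0 < I₂ / m * (lam - v x) * (φ x - a) :=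
      mul_pos (mul_pos hα0 (by linarith)) (by linarith)
    exact h1.ne' hx
  have habove' : ∀ᵐ x, x ∈ B → c < φ x → lam ≤ v x := by
    have h1 : ∀ᵐ x, ∀ n : ℕ, x ∈ B → c + 1 / ((n : ℝ) + 1) < φ x → lam ≤ v x :=
      ae_all_iff.2 fun n => habove _ (lt_add_of_pos_right _ (by positivity))
    filter_upwards [h1] with x hx hxB hcx
    obtain ⟨n, hn⟩ := exists_nat_one_div_lt (sub_pos.2 hcx)
    exact hx n hxB (by linarith)
  filter_upwards [hv, hlow, habove', hlev c] with x hx h1 h2 h3 hxB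
  split_ifs with hcx
  · exact le_antisymm hx.2 (h2 hxB hcx)
  · rcases (not_lt.1 hcx).lt_or_eq with h | h
    · exact le_antisymm (not_lt.1 fun h0 => (h1 ⟨hxB, h0⟩).not_gt h) hx.1
    · exact h3 hxB h

section Kernel

variable {N : E2 → E2 → ℝ} {g : E2 → ℝ}

theorem integrable_kernel_mul (hNm : Measurable (Function.uncurry N)) (hg : Integrable g)
    (hNg : ∀ x y, |N x y| ≤ g (x - y)) {u : E2 → ℝ} {M : ℝ} (hum : Measurable u)
    (hub : ∀ᵐ x, |u x| ≤ M) (x : E2) : Integrable fun y => N x y * u y := by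
  refine ((hg.comp_sub_left x).mul_const M).mono'
    ((hNm.of_uncurry_left.mul hum).aestronglyMeasurable) ?_
  filter_upwards [hub] with y hy
  rw [norm_mul]
  exact mul_le_mul (hNg x y) hy (abs_nonneg _) ((abs_nonneg _).trans (hNg x y))

theorem abs_integral_kernel_mul_le (hg : Integrable g)
    (hNg : ∀ x y, |N x y| ≤ g (x - y)) {u : E2 → ℝ} {M : ℝ}
    (hub : ∀ᵐ x, |u x| ≤ M) (x : E2) : |∫ y, N x y * u y| ≤ (∫ y, g y) * M := by
  have h1 : ∫ y, g (x - y) * M = (∫ y, g y) * M := by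
    rw [integral_mul_const, integral_sub_left_eq_self g volume x]
  rw [← h1, ← Real.norm_eq_abs]
  refine norm_integral_le_of_norm_le ((hg.comp_sub_left x).mul_const M) ?_
  filter_upwards [hub] with y hy
  rw [norm_mul]
  exact mul_le_mul (hNg x y) hy (abs_nonneg _) ((abs_nonneg _).trans (hNg x y))

theorem measurable_integral_kernel_mul (hNm : Measurable (Function.uncurry N)) {u : E2 → ℝ}
    (hum : Measurable u) : Measurable fun x => ∫ y, N x y * u y := by
  have h1 : StronglyMeasurable (Function.uncurry fun x y => N x y * u y) :=
    (hNm.mul (hum.comp measurable_snd)).stronglyMeasurable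
  exact h1.integral_prod_right.measurable

theorem integrable_prod_kernel_mul (hNm : Measurable (Function.uncurry N)) (hg : Integrable g)
    (hNg : ∀ x y, |N x y| ≤ g (x - y)) {u v : E2 → ℝ} {M : ℝ} (hum : Measurable u)
    (hub : ∀ᵐ x, |u x| ≤ M) (hvm : Measurable v) (hvi : Integrable v) :
    Integrable (fun q : E2 × E2 => u q.1 * (N q.1 q.2 * v q.2)) (volume.prod volume) := by
  have h1 := (Integrable.convolution_integrand (ContinuousLinearMap.mul ℝ ℝ) (μ := volume)
    (ν := volume) hvi.abs hg).const_mul M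
  refine h1.mono' ((hum.comp measurable_fst).mul
    (hNm.mul (hvm.comp measurable_snd))).aestronglyMeasurable ?_
  have h2 : ∀ᵐ q : E2 × E2 ∂volume.prod volume, |u q.1| ≤ M :=
    Measure.quasiMeasurePreserving_fst.ae hub
  filter_upwards [h2] with q hq
  have h3 := hNg q.1 q.2
  rw [norm_mul, norm_mul, ContinuousLinearMap.mul_apply', mul_comm |v q.2|]
  exact mul_le_mul hq (mul_le_mul_of_nonneg_right h3 (abs_nonneg _)) (by positivity)
    ((abs_nonneg _).trans hq)

theorem integrable_mul_integral_kernel (hNm : Measurable (Function.uncurry N)) (hg : Integrable g)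
    (hNg : ∀ x y, |N x y| ≤ g (x - y)) {u v : E2 → ℝ} {M : ℝ} (hum : Measurable u)
    (hub : ∀ᵐ x, |u x| ≤ M) (hvi : Integrable v) :
    Integrable fun x => v x * ∫ y, N x y * u y := by
  simp only [mul_comm (v _)]
  exact hvi.bdd_mul (measurable_integral_kernel_mul hNm hum).aestronglyMeasurable
    (.of_forall fun x => abs_integral_kernel_mul_le hg hNg hub x)

theorem integral_mul_integral_kernel_comm (hNm : Measurable (Function.uncurry N))
    (hg : Integrable g) (hNg : ∀ x y, |N x y| ≤ g (x - y)) (hNs : ∀ x y, N x y = N y x)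
    {u v : E2 → ℝ} {M : ℝ} (hum : Measurable u) (hub : ∀ᵐ x, |u x| ≤ M) (hvm : Measurable v)
    (hvi : Integrable v) :
    ∫ x, u x * ∫ y, N x y * v y = ∫ x, v x * ∫ y, N x y * u y := by
  simp only [← integral_const_mul]
  rw [integral_integral_swap (f := fun x y => u x * (N x y * v y))
    (integrable_prod_kernel_mul hNm hg hNg hum hub hvm hvi)]
  refine integral_congr_ae (.of_forall fun y => integral_congr_ae (.of_forall fun x => ?_))
  simp only [hNs x y]
  ring

/-- The first variation of a quadratic-plus-linear energy at a maximum along `η` is nonpositive. -/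
theorem integral_mul_potential_nonpos_of_max (hNm : Measurable (Function.uncurry N))
    (hg : Integrable g) (hNg : ∀ x y, |N x y| ≤ g (x - y)) (hNs : ∀ x y, N x y = N y x)
    {u v b : E2 → ℝ} {M M' : ℝ} (hum : Measurable u) (hub : ∀ᵐ x, |u x| ≤ M) (hui : Integrable u)
    (hvm : Measurable v) (hvb : ∀ᵐ x, |v x| ≤ M') (hvi : Integrable v)
    (hbu : Integrable fun x => b x * u x) (hbv : Integrable fun x => b x * v x)
    (hmax : ∀ t : ℝ, 0 ≤ t → t ≤ 1 →
      1 / 2 * (∫ x, (u x + t * v x) * ∫ y, N x y * (u y + t * v y)) +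
        ∫ x, b x * (u x + t * v x) ≤
      1 / 2 * (∫ x, u x * ∫ y, N x y * u y) + ∫ x, b x * u x) :
    ∫ x, v x * ((∫ y, N x y * u y) + b x) ≤ 0 := by
  have hNu := fun x => integrable_kernel_mul hNm hg hNg hum hub x
  have hNv := fun x => integrable_kernel_mul hNm hg hNg hvm hvb x
  have huu := integrable_mul_integral_kernel hNm hg hNg hum hub hui
  have huv := integrable_mul_integral_kernel hNm hg hNg hvm hvb hui
  have hvu := integrable_mul_integral_kernel hNm hg hNg hum hub hvi
  have hvv := integrable_mul_integral_kernel hNm hg hNg hvm hvb hvi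
  have hcomm := integral_mul_integral_kernel_comm hNm hg hNg hNs hum hub hvm hvi
  have hexp : ∀ t : ℝ, ∫ x, (u x + t * v x) * ∫ y, N x y * (u y + t * v y) =
      (∫ x, u x * ∫ y, N x y * u y) + 2 * t * (∫ x, v x * ∫ y, N x y * u y) +
        t ^ 2 * ∫ x, v x * ∫ y, N x y * v y := by
    intro t
    have h1 : ∀ x, (u x + t * v x) * ∫ y, N x y * (u y + t * v y) =
        u x * (∫ y, N x y * u y) + t * (u x * ∫ y, N x y * v y) +
          t * (v x * ∫ y, N x y * u y) + t ^ 2 * (v x * ∫ y, N x y * v y) := by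
      intro x
      have h2 : ∫ y, N x y * (u y + t * v y) =
          (∫ y, N x y * u y) + t * ∫ y, N x y * v y := by
        rw [← integral_const_mul, ← integral_add (hNu x) ((hNv x).const_mul t)]
        refine integral_congr_ae (.of_forall fun y => ?_)
        simp only
        ring
      rw [h2]
      ring
    simp only [h1]
    rw [integral_add (by exact (huu.add (huv.const_mul t)).add (hvu.const_mul t))
        (hvv.const_mul _),
      integral_add (by exact huu.add (huv.const_mul t)) (hvu.const_mul t),
      integral_add huu (huv.const_mul t), integral_const_mul, integral_const_mul,
      integral_const_mul, hcomm]
    ring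
  have hlin : ∀ t : ℝ, ∫ x, b x * (u x + t * v x) =
      (∫ x, b x * u x) + t * ∫ x, b x * v x := by
    intro t
    rw [← integral_const_mul, ← integral_add hbu (hbv.const_mul t)]
    refine integral_congr_ae (.of_forall fun x => ?_)
    simp only
    ring
  have hL : ∫ x, v x * ((∫ y, N x y * u y) + b x) =
      (∫ x, v x * ∫ y, N x y * u y) + ∫ x, b x * v x := by
    rw [← integral_add hvu hbv]
    refine integral_congr_ae (.of_forall fun x => ?_)
    simp only
    ring
  rw [hL]
  set L := (∫ x, v x * ∫ y, N x y * u y) + ∫ x, b x * v x with hLdef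
  set Q := ∫ x, v x * ∫ y, N x y * v y
  have hineq : ∀ t : ℝ, 0 < t → t ≤ 1 → L + t * (Q / 2) ≤ 0 := by
    intro t ht ht1
    have h1 := hmax t ht.le ht1
    rw [hexp, hlin] at h1
    refine le_of_mul_le_mul_left ?_ ht
    rw [hLdef]
    linarith
  by_contra hpos
  rw [not_le] at hpos
  have hlim : Tendsto (fun t : ℝ => L + t * (Q / 2)) (𝓝[>] 0) (𝓝 L) := by
    have : Continuous fun t : ℝ => L + t * (Q / 2) := by fun_prop
    simpa using (this.tendsto 0).mono_left nhdsWithin_le_nhds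
  refine hpos.not_ge (le_of_tendsto hlim ?_)
  filter_upwards [Ioc_mem_nhdsGT (show (0 : ℝ) < 1 by norm_num)] with t ht
  exact hineq t ht.1 ht.2

/-- Mean value deficit of the potential of a density `f` supported in `K`. -/
theorem setIntegral_closedBall_potential_deficit (hNm : Measurable (Function.uncurry N))
    (hg : Integrable g) (hNg : ∀ x y, |N x y| ≤ g (x - y)) {f : E2 → ℝ} {M : ℝ}
    (hfm : Measurable f) (hfb : ∀ᵐ x, |f x| ≤ M) (hfi : Integrable f) {K : Set E2}
    (hfK : ∀ x, x ∉ K → f x = 0) {y : E2} {r : ℝ}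
    (hdef : ∀ w ∈ K, y ≠ w →
      ∫ u in closedBall y r, (N y w - N u w) = logDeficit r (dist y w)) :
    (Integrable fun w => logDeficit r (dist y w) * f w) ∧
      ∫ u in closedBall y r, ((∫ w, N y w * f w) - ∫ w, N u w * f w) =
        ∫ w, logDeficit r (dist y w) * f w := by
  have hNf := fun x => integrable_kernel_mul hNm hg hNg hfm hfb x
  have hfin : IsFiniteMeasure (volume.restrict (closedBall y r)) :=
    isFiniteMeasure_restrict.2 measure_closedBall_lt_top.ne
  have h1 : Integrable (fun q : E2 × E2 => N q.1 q.2 * f q.2)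
      ((volume.restrict (closedBall y r)).prod volume) := by
    have h2 := (integrable_prod_kernel_mul hNm hg hNg (u := fun _ => 1) (M := 1)
      measurable_const (by simp) hfm hfi).integrableOn (s := closedBall y r ×ˢ Set.univ)
    rw [IntegrableOn, ← Measure.prod_restrict, Measure.restrict_univ] at h2
    simpa using h2
  have h2 : Integrable (fun q : E2 × E2 => N y q.2 * f q.2 - N q.1 q.2 * f q.2)
      ((volume.restrict (closedBall y r)).prod volume) := ((hNf y).comp_snd _).sub h1
  have h3 : (fun w => ∫ u in closedBall y r, (N y w * f w - N u w * f w)) =ᵐ[volume]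
      fun w => logDeficit r (dist y w) * f w := by
    have h4 : ∀ᵐ w : E2, w ≠ y := by simp [ae_iff]
    filter_upwards [h4] with w hw
    by_cases hwK : w ∈ K
    · rw [← hdef w hwK hw.symm, ← integral_mul_const]
      simp only [sub_mul]
    · simp [hfK w hwK]
  refine ⟨h2.integral_prod_right.congr h3, ?_⟩
  rw [← integral_congr_ae h3,
    ← integral_integral_swap (f := fun u w => N y w * f w - N u w * f w) h2]
  refine integral_congr_ae (.of_forall fun u => ?_)
  exact (integral_sub (hNf y) (hNf u)).symm

theorem integral_logDeficit_mul_bounds {f : E2 → ℝ} {U : Set E2} {lam : ℝ}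
    (hf : ∀ᵐ x, x ∈ U → 0 ≤ f x ∧ f x ≤ lam) {y : E2} {r : ℝ} (hr : 0 < r)
    (hlam : 0 ≤ lam) (hyU : closedBall y r ⊆ U)
    (hi : Integrable fun w => logDeficit r (dist y w) * f w) (hfi : Integrable f) :
    log 2 / 4 * r ^ 2 * ∫ w in closedBall y (r / 4), f w ≤
        ∫ w, logDeficit r (dist y w) * f w ∧
      |∫ w, logDeficit r (dist y w) * f w| ≤
        lam * (∫ u : E2, log⁺ (1 / ‖u‖)) * r ^ 4 := by
  have hne : ∀ᵐ w : E2, w ≠ y := by simp [ae_iff]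
  have hzero : ∀ w, w ∉ closedBall y r → logDeficit r (dist y w) = 0 := fun w hw => by
    rw [mem_closedBall, not_le, dist_comm] at hw
    exact logDeficit_eq_zero (hr.trans hw) hw.le
  have hnn : 0 ≤ᵐ[volume] fun w => logDeficit r (dist y w) * f w := by
    filter_upwards [hf] with w hw
    by_cases hwb : w ∈ closedBall y r
    · exact mul_nonneg (logDeficit_nonneg _ _) (hw (hyU hwb)).1
    · simp [hzero w hwb]
  constructor
  · rw [← integral_const_mul, ← integral_indicator measurableSet_closedBall]
    refine integral_mono_ae ((integrable_indicator_iff measurableSet_closedBall).2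
      (hfi.integrableOn.const_mul _)) hi ?_
    filter_upwards [hf, hne, hnn] with w hw hwy hwn
    by_cases hwb : w ∈ closedBall y (r / 4)
    · rw [Set.indicator_of_mem hwb]
      refine mul_le_mul_of_nonneg_right (le_logDeficit hr (dist_pos.2 hwy.symm) ?_)
        (hw (hyU (closedBall_subset_closedBall (by linarith) hwb))).1
      rw [dist_comm]
      exact hwb
    · rw [Set.indicator_of_notMem hwb]
      exact hwn
  · rw [abs_of_nonneg (integral_nonneg_of_ae hnn)]
    obtain ⟨hli, hl⟩ := integral_posLog_div_dist y hr
    have h1 : lam * (∫ u : E2, log⁺ (1 / ‖u‖)) * r ^ 4 =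
        ∫ w, r ^ 2 * log⁺ (r / dist y w) * lam := by
      rw [integral_mul_const, integral_const_mul, hl]
      ring
    rw [h1]
    refine integral_mono_ae hi ((hli.const_mul _).mul_const _) ?_
    filter_upwards [hf, hne] with w hw hwy
    have h2 : 0 ≤ r ^ 2 * log⁺ (r / dist y w) := mul_nonneg (by positivity) posLog_nonneg
    by_cases hwb : w ∈ closedBall y r
    · have hw' := hw (hyU hwb)
      exact mul_le_mul (logDeficit_le hr.le (dist_pos.2 hwy.symm)) hw'.2 hw'.1 h2
    · rw [hzero w hwb, zero_mul]
      exact mul_nonneg h2 hlam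

end Kernel

theorem integrable_of_ae_bounded_of_eq_zero {u : E2 → ℝ} {S : Set E2} {M : ℝ}
    (hS : volume S ≠ ⊤) (hum : Measurable u) (hub : ∀ᵐ x, |u x| ≤ M)
    (huS : ∀ x, x ∉ S → u x = 0) : Integrable u := by
  have h1 : IntegrableOn u S :=
    Measure.integrableOn_of_bounded hS hum.aestronglyMeasurable (ae_restrict_of_ae hub)
  rwa [integrableOn_iff_integrable_of_support_subset] at h1
  exact fun x hx => by_contra fun hxS => hx (huS x hxS)

/-- A density maximizing a quadratic-plus-linear kernel energy among densities with prescribed mass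
and `0 ≤ s * ω ≤ lam` on `B` is a patch on a superlevel set of its potential. -/
theorem ae_eq_ite_of_kernel_energy_max {N : E2 → E2 → ℝ} {g : E2 → ℝ}
    (hNm : Measurable (Function.uncurry N)) (hg : Integrable g)
    (hNg : ∀ x y, |N x y| ≤ g (x - y)) (hNs : ∀ x y, N x y = N y x)
    {ω b : E2 → ℝ} {K B : Set E2} {s lam M : ℝ} (hs : s * s = 1) (hlam : 0 ≤ lam)
    (hωm : Measurable ω) (hωb : ∀ᵐ x, |ω x| ≤ lam) (hωi : Integrable ω)
    (hωK : ∀ x, x ∉ K → ω x = 0) (hB : IsOpen B) (hBf : volume B ≠ ⊤)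
    (hωB : ∀ᵐ x, x ∈ B → 0 ≤ s * ω x ∧ s * ω x ≤ lam) (hpos : 0 < ∫ x in B, s * ω x)
    (hbm : Measurable b) (hbB : ∀ x ∈ B, |b x| ≤ M)
    (hbi : ∀ u : E2 → ℝ, Measurable u → (∀ᵐ x, |u x| ≤ lam) → Integrable fun x => b x * u x)
    (hdef : ∀ y r, 0 < r → closedBall y r ⊆ B → ∀ w ∈ K, y ≠ w →
      ∫ u in closedBall y r, (N y w - N u w) = logDeficit r (dist y w))
    (hbdef : ∀ y r, 0 < r → closedBall y r ⊆ B → ∫ u in closedBall y r, (b y - b u) = 0)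
    (hmax : ∀ η : E2 → ℝ, Measurable η → Integrable η → (∀ x, x ∉ B → η x = 0) → ∫ x, η x = 0 →
      (∀ᵐ x, x ∈ B → 0 ≤ s * (ω x + η x) ∧ s * (ω x + η x) ≤ lam) →
      1 / 2 * (∫ x, (ω x + η x) * ∫ y, N x y * (ω y + η y)) + ∫ x, b x * (ω x + η x) ≤
        1 / 2 * (∫ x, ω x * ∫ y, N x y * ω y) + ∫ x, b x * ω x) :
    ∀ᵐ x, x ∈ B → s * ω x =
      if essInf (fun x => s * ((∫ y, N x y * ω y) + b x))
          (volume.restrict {x ∈ B | 0 < s * ω x}) < s * ((∫ y, N x y * ω y) + b x)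
        then lam else 0 := by
  classical
  have hs1 : |s| = 1 := by
    have h1 : |s| * |s| = 1 := by rw [abs_mul_abs_self, hs]
    nlinarith [abs_nonneg s]
  have hBm := hB.measurableSet
  have hPm := measurable_integral_kernel_mul hNm hωm
  set φ : E2 → ℝ := fun x => s * ((∫ y, N x y * ω y) + b x) with hφ
  have hφm : Measurable φ := (hPm.add hbm).const_mul s
  have hφb : ∀ x ∈ B, |φ x| ≤ (∫ y, g y) * lam + M := fun x hx => by
    rw [hφ, abs_mul, hs1, one_mul]
    exact (abs_add_le _ _).trans
      (add_le_add (abs_integral_kernel_mul_le hg hNg hωb x) (hbB x hx))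
  have hfm : Measurable fun x => s * ω x := hωm.const_mul s
  have hfi : Integrable fun x => s * ω x := hωi.const_mul s
  set v : E2 → ℝ := B.indicator fun x => s * ω x with hv
  have hvB : ∀ x ∈ B, v x = s * ω x := fun x hx => Set.indicator_of_mem hx _
  have hv01 : ∀ᵐ x, 0 ≤ v x ∧ v x ≤ lam := by
    filter_upwards [hωB] with x hx
    by_cases hxB : x ∈ B
    · rw [hvB x hxB]
      exact hx hxB
    · rw [hv, Set.indicator_of_notMem hxB]
      exact ⟨le_rfl, hlam⟩
  have hlev : ∀ c, ∀ᵐ x, x ∈ B → φ x = c → s * ω x = 0 := by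
    have hcalc : ∀ y r, 0 < r → closedBall y r ⊆ B →
        (Integrable fun w => logDeficit r (dist y w) * (s * ω w)) ∧
          ∫ u in closedBall y r, (φ y - φ u) = ∫ w, logDeficit r (dist y w) * (s * ω w) := by
      intro y r hr hyr
      obtain ⟨h1, h2⟩ := setIntegral_closedBall_potential_deficit hNm hg hNg hωm hωb hωi hωK
        (hdef y r hr hyr)
      have h3 : (fun w => logDeficit r (dist y w) * (s * ω w)) =
          fun w => s * (logDeficit r (dist y w) * ω w) := by
        funext w
        ring
      have hc : ∀ a : ℝ, IntegrableOn (fun _ : E2 => a) (closedBall y r) := fun a =>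
        integrableOn_const measure_closedBall_lt_top.ne
      have hPi : IntegrableOn (fun x => ∫ y, N x y * ω y) (closedBall y r) :=
        Measure.integrableOn_of_bounded measure_closedBall_lt_top.ne hPm.aestronglyMeasurable
          (.of_forall fun x => abs_integral_kernel_mul_le hg hNg hωb x)
      have hbint : IntegrableOn b (closedBall y r) :=
        Measure.integrableOn_of_bounded measure_closedBall_lt_top.ne hbm.aestronglyMeasurable
          ((ae_restrict_mem measurableSet_closedBall).mono fun x hx => hbB x (hyr hx))
      rw [h3]
      refine ⟨h1.const_mul s, ?_⟩
      rw [integral_const_mul, ← h2, ← integral_const_mul]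
      have h4 : ∀ u, φ y - φ u = s * ((∫ w, N y w * ω w) - ∫ w, N u w * ω w) +
          s * (b y - b u) := fun u => by
        simp only [hφ]
        ring
      simp only [h4]
      rw [integral_add (by exact ((hc _).sub hPi).const_mul s)
        (by exact ((hc _).sub hbint).const_mul s), integral_const_mul s (fun u => b y - b u),
        hbdef y r hr hyr, mul_zero, add_zero]
    exact ae_eq_zero_on_levelSet hB hφm hφb hfm
      (hωB.mono fun x hx hxB => (hx hxB).1) hfi.integrableOn
      (a := log 2 / 4) (div_pos (log_pos one_lt_two) (by norm_num))
      (fun y r hr hyr => by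
        rw [(hcalc y r hr hyr).2]
        exact (integral_logDeficit_mul_bounds hωB hr hlam hyr (hcalc y r hr hyr).1 hfi).2)
      (fun y r hr hyr => by
        rw [(hcalc y r hr hyr).2]
        exact (integral_logDeficit_mul_bounds hωB hr hlam hyr (hcalc y r hr hyr).1 hfi).1)
  have hopt : ∀ η : E2 → ℝ, Measurable η → (∀ x, x ∉ B → η x = 0) → ∫ x, η x = 0 →
      (∀ᵐ x, 0 ≤ v x + η x ∧ v x + η x ≤ lam) → ∫ x, η x * φ x ≤ 0 := by
    intro η hηm hηB hη0 hηv
    have hηb : ∀ᵐ x, |s * η x| ≤ lam := by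
      filter_upwards [hv01, hηv] with x h1 h2
      rw [abs_mul, hs1, one_mul, abs_le]
      constructor <;> linarith
    have hsηm : Measurable fun x => s * η x := hηm.const_mul s
    have hsηi : Integrable fun x => s * η x :=
      integrable_of_ae_bounded_of_eq_zero hBf hsηm hηb fun x hx => by simp [hηB x hx]
    have h1 := integral_mul_potential_nonpos_of_max hNm hg hNg hNs hωm hωb hωi hsηm hηb hsηi
      (hbi ω hωm hωb) (hbi _ hsηm hηb) fun t ht ht1 => by
        refine hmax (fun x => t * (s * η x)) (hsηm.const_mul t) (hsηi.const_mul t)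
          (fun x hx => by simp [hηB x hx])
          (by rw [integral_const_mul, integral_const_mul, hη0, mul_zero, mul_zero]) ?_
        filter_upwards [hv01, hηv] with x h1 h2 hxB
        rw [hvB x hxB] at h1 h2
        have h3 : s * (ω x + t * (s * η x)) = s * ω x + t * η x := by
          linear_combination t * η x * hs
        rw [h3]
        constructor <;> nlinarith
    refine le_of_eq_of_le (integral_congr_ae (.of_forall fun x => ?_)) h1
    simp only [hφ]
    ring
  have hset : {x ∈ B | 0 < v x} = {x ∈ B | 0 < s * ω x} :=
    Set.ext fun x => and_congr_right fun hx => by rw [hvB x hx]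
  have hmain := ae_eq_ite_essInf_lt_of_optimal hBm hBf hφm hφb (hfm.indicator hBm) hv01
    (by rwa [setIntegral_congr_fun hBm hvB]) hopt
    fun c => (hlev c).mono fun x hx hxB hc => (hvB x hxB).trans (hx hxB hc)
  rw [hset] at hmain
  exact hmain.mono fun x hx hxB => (hvB x hxB).symm.trans (hx hxB)

/-- The kernel `G` restricted to `K × K` and extended by zero. -/
def truncatedKernel (K : Set E2) (G : E2 → E2 → ℝ) (x y : E2) : ℝ :=
  (K ×ˢ K).indicator (Function.uncurry G) (x, y)

section TruncatedKernel

variable {K : Set E2} {G : E2 → E2 → ℝ}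

theorem truncatedKernel_of_mem {x y : E2} (hx : x ∈ K) (hy : y ∈ K) :
    truncatedKernel K G x y = G x y :=
  Set.indicator_of_mem (Set.mk_mem_prod hx hy) _

theorem truncatedKernel_comm (hG : ∀ x ∈ K, ∀ y ∈ K, G x y = G y x) (x y : E2) :
    truncatedKernel K G x y = truncatedKernel K G y x := by
  by_cases hxy : x ∈ K ∧ y ∈ K
  · rw [truncatedKernel_of_mem hxy.1 hxy.2, truncatedKernel_of_mem hxy.2 hxy.1,
      hG x hxy.1 y hxy.2]
  · rw [truncatedKernel, truncatedKernel, Set.indicator_of_notMem (s := K ×ˢ K) hxy,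
      Set.indicator_of_notMem (s := K ×ˢ K) fun h => hxy ⟨h.2, h.1⟩]

theorem measurable_truncatedKernel {h : E2 → E2 → ℝ} (hK : IsCompact K)
    (hh : ContinuousOn (Function.uncurry h) (K ×ˢ K))
    (hG : ∀ x y, G x y = (1 / (2 * π)) * log (1 / dist x y) - h x y) :
    Measurable (Function.uncurry (truncatedKernel K G)) := by
  classical
  have hKm : MeasurableSet (K ×ˢ K) := hK.measurableSet.prod hK.measurableSet
  have h1 : Measurable ((K ×ˢ K).indicator (Function.uncurry h)) := by
    rw [← Set.piecewise_eq_indicator]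
    exact hh.measurable_piecewise continuousOn_const hKm
  have h2 : Measurable fun q : E2 × E2 => (1 / (2 * π)) * log (1 / dist q.1 q.2) :=
    (measurable_log.comp ((measurable_fst.dist measurable_snd).const_div 1)).const_mul _
  have h3 : Function.uncurry (truncatedKernel K G) =
      (K ×ˢ K).indicator (fun q => (1 / (2 * π)) * log (1 / dist q.1 q.2)) -
        (K ×ˢ K).indicator (Function.uncurry h) := by
    rw [← Set.indicator_sub']
    refine funext fun q => congrArg (fun f => (K ×ˢ K).indicator f q) ?_
    exact funext fun q => hG q.1 q.2
  rw [h3]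
  exact (h2.indicator hKm).sub h1

theorem exists_abs_truncatedKernel_le {h : E2 → E2 → ℝ} (hK : IsCompact K)
    (hh : ContinuousOn (Function.uncurry h) (K ×ˢ K))
    (hG : ∀ x y, G x y = (1 / (2 * π)) * log (1 / dist x y) - h x y) :
    ∃ C R : ℝ, 0 ≤ C ∧ ∀ x y, |truncatedKernel K G x y| ≤
      (1 / (2 * π)) * (ball (0 : E2) R).indicator (fun u => |log ‖u‖|) (x - y) +
        (ball (0 : E2) R).indicator (fun _ => C) (x - y) := by
  obtain ⟨C, hC⟩ := (hK.prod hK).exists_bound_of_continuousOn hh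
  obtain ⟨R, hR⟩ := hK.isBounded.subset_closedBall 0
  refine ⟨|C|, 2 * R + 1, abs_nonneg C, fun x y => ?_⟩
  by_cases hxy : x ∈ K ∧ y ∈ K
  · have hx := mem_closedBall_zero_iff.1 (hR hxy.1)
    have hy := mem_closedBall_zero_iff.1 (hR hxy.2)
    have hm : x - y ∈ ball (0 : E2) (2 * R + 1) := by
      rw [mem_ball_zero_iff]
      linarith [norm_sub_le x y]
    rw [truncatedKernel_of_mem hxy.1 hxy.2, hG, Set.indicator_of_mem hm, Set.indicator_of_mem hm,
      dist_eq_norm, one_div ‖x - y‖, log_inv]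
    refine (abs_sub _ _).trans (add_le_add (le_of_eq ?_) ((hC (x, y) hxy).trans (le_abs_self C)))
    rw [abs_mul, abs_neg, abs_of_nonneg (by positivity)]
  · rw [truncatedKernel, Set.indicator_of_notMem (s := K ×ˢ K) hxy, abs_zero]
    exact add_nonneg
      (mul_nonneg (by positivity) (Set.indicator_nonneg (fun _ _ => abs_nonneg _) _))
      (Set.indicator_nonneg (fun _ _ => abs_nonneg _) _)

theorem exists_integrable_bound_truncatedKernel {h : E2 → E2 → ℝ} (hK : IsCompact K)
    (hh : ContinuousOn (Function.uncurry h) (K ×ˢ K))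
    (hG : ∀ x y, G x y = (1 / (2 * π)) * log (1 / dist x y) - h x y) :
    ∃ g : E2 → ℝ, Integrable g ∧ ∀ x y, |truncatedKernel K G x y| ≤ g (x - y) := by
  obtain ⟨C, R, -, hCR⟩ := exists_abs_truncatedKernel_le hK hh hG
  exact ⟨_, ((integrable_indicator_ball_abs_log_norm R).const_mul _).add
    ((integrable_indicator_iff measurableSet_ball).2
      (integrableOn_const measure_ball_lt_top.ne)), hCR⟩

theorem exists_bound_truncatedKernel {h : E2 → E2 → ℝ} (hK : IsCompact K)
    (hh : ContinuousOn (Function.uncurry h) (K ×ˢ K))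
    (hG : ∀ x y, G x y = (1 / (2 * π)) * log (1 / dist x y) - h x y) {ε : ℝ} (hε : 0 < ε) :
    ∃ M, ∀ x y, ε ≤ dist x y → |truncatedKernel K G x y| ≤ M := by
  obtain ⟨C, R, hC, hCR⟩ := exists_abs_truncatedKernel_le hK hh hG
  refine ⟨(1 / (2 * π)) * (|log ε| + |log R|) + C, fun x y hxy => (hCR x y).trans ?_⟩
  rw [dist_eq_norm] at hxy
  gcongr
  · refine Set.indicator_apply_le' (fun hm => ?_) fun _ => by positivity
    rw [mem_ball_zero_iff] at hm
    have h1 := log_le_log hε hxy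
    have h2 := log_le_log (hε.trans_le hxy) hm.le
    rw [abs_le]
    constructor <;> linarith [neg_abs_le (log ε), le_abs_self (log R), abs_nonneg (log ε),
      abs_nonneg (log R)]
  · exact Set.indicator_apply_le' (fun _ => le_rfl) fun _ => hC

theorem setIntegral_kernel_mul_eq {D : Set E2} (hD : MeasurableSet D) (hKD : K ⊆ D) {ω : E2 → ℝ}
    (hω : ∀ x, x ∉ K → ω x = 0) {x : E2} (hx : x ∈ K) :
    ∫ y in D, G x y * ω y = ∫ y, truncatedKernel K G x y * ω y := by
  rw [← integral_indicator hD]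
  refine integral_congr_ae (.of_forall fun y => ?_)
  by_cases hy : y ∈ K
  · simp [Set.indicator_of_mem (hKD hy), truncatedKernel_of_mem hx hy]
  · simp [hω y hy]

theorem setIntegral_energy_eq {D : Set E2} (hD : MeasurableSet D) (hKD : K ⊆ D) {ω : E2 → ℝ}
    (hω : ∀ x, x ∉ K → ω x = 0) :
    ∫ x in D, ∫ y in D, G x y * ω x * ω y =
      ∫ x, ω x * ∫ y, truncatedKernel K G x y * ω y := by
  rw [← integral_indicator hD]
  refine integral_congr_ae (.of_forall fun x => ?_)
  by_cases hx : x ∈ K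
  · simp only [Set.indicator_of_mem (hKD hx)]
    rw [← setIntegral_kernel_mul_eq hD hKD hω hx, ← integral_const_mul]
    refine integral_congr_ae (.of_forall fun y => ?_)
    simp only
    ring
  · simp [hω x hx]

end TruncatedKernel

theorem sum_apply_eq_of_mem {ι : Type*} [Fintype ι] {B : ι → Set E2}
    (hB : ∀ i j, i ≠ j → Disjoint (B i) (B j)) {f : ι → E2 → ℝ}
    (hf : ∀ i x, x ∉ B i → f i x = 0) {i : ι} {x : E2} (hx : x ∈ B i) :
    (∑ i', f i') x = f i x := by
  rw [Finset.sum_apply]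
  exact Finset.sum_eq_single i
    (fun j _ hj => hf j x ((hB i j hj.symm).notMem_of_mem_left hx)) (by simp)

theorem sum_apply_eq_zero {ι : Type*} [Fintype ι] {B : ι → Set E2} {f : ι → E2 → ℝ}
    (hf : ∀ i x, x ∉ B i → f i x = 0) {x : E2} (hx : ∀ i, x ∉ B i) : (∑ i', f i') x = 0 := by
  rw [Finset.sum_apply]
  exact Finset.sum_eq_zero fun i _ => hf i x (hx i)

theorem ae_abs_sum_le {ι : Type*} [Fintype ι] {B : ι → Set E2}
    (hB : ∀ i j, i ≠ j → Disjoint (B i) (B j)) {f : ι → E2 → ℝ} {M : ℝ} (hM : 0 ≤ M)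
    (hf : ∀ i x, x ∉ B i → f i x = 0) (hfM : ∀ i, ∀ᵐ x, |f i x| ≤ M) :
    ∀ᵐ x, |(∑ i', f i') x| ≤ M := by
  filter_upwards [ae_all_iff.2 hfM] with x hx
  by_cases h : ∃ i, x ∈ B i
  · obtain ⟨i, hi⟩ := h
    rw [sum_apply_eq_of_mem hB hf hi]
    exact hx i
  · rw [sum_apply_eq_zero hf (not_exists.1 h), abs_zero]
    exact hM

theorem sign_mul_sign_self {a : ℝ} (ha : a ≠ 0) : Real.sign a * Real.sign a = 1 := by
  rcases ha.lt_or_gt with h | h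
  · rw [sign_of_neg h]
    norm_num
  · rw [sign_of_pos h]
    norm_num

theorem abs_le_of_sign_mul {a t M : ℝ} (ha : a ≠ 0)
    (h : 0 ≤ Real.sign a * t ∧ Real.sign a * t ≤ M) : |t| ≤ M := by
  rcases ha.lt_or_gt with h' | h'
  · rw [sign_of_neg h'] at h
    rw [abs_le]
    constructor <;> linarith
  · rw [sign_of_pos h'] at h
    rw [abs_le]
    constructor <;> linarith

theorem patch_profile
    (p l : ℕ) (hp : 0 < p) (hl : 0 < l)
    (D : Set E2) (hDopen : IsOpen D) (hDbdd : Bornology.IsBounded D)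
    (hDsc : SimplyConnectedSpace D)
    (h : E2 → E2 → ℝ)
    (hcont : ContinuousOn (fun q : E2 × E2 => h q.1 q.2) (D ×ˢ D))
    (hsymm : ∀ x ∈ D, ∀ y ∈ D, h x y = h y x)
    (hharm : ∀ y ∈ D, ContDiffOn ℝ 2 (fun x => h x y) D ∧
      ∀ x ∈ D, ∑ i : Fin 2,
        iteratedFDerivWithin ℝ 2 (fun x' => h x' y) D x
          ![EuclideanSpace.single i 1, EuclideanSpace.single i 1] = 0)
    (G : E2 → E2 → ℝ)
    (hG : ∀ x y, G x y = (1 / (2 * π)) * Real.log (1 / dist x y) - h x y)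
    (hGbdry : ∀ y ∈ D, ∀ z ∈ frontier D,
      Tendsto (fun x => G x y) (𝓝[D] z) (𝓝 0))
    (κ : Fin (p + l) → ℝ) (hκ : ∀ i, κ i ≠ 0)
    (xb : Fin (p + l) → E2) (hxbD : ∀ i, xb i ∈ D) (hxbinj : Function.Injective xb)
    (δ0 : ℝ) (hδ0 : 0 < δ0)
    (hball : ∀ i, closedBall (xb i) δ0 ⊆ D)
    (hdisj : ∀ i j, i ≠ j → Disjoint (closedBall (xb i) δ0) (closedBall (xb j) δ0))
    (KR : (Fin (p + l) → E2) → ℝ)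
    (hKR : ∀ y, KR y =
      -(∑ i, ∑ j ∈ Finset.univ.filter (fun j => j ≠ i), κ i * κ j * G (y i) (y j))
      + ∑ i, (κ i) ^ 2 * h (y i) (y i))
    (hmin : ∀ y : Fin (p + l) → E2, (∀ i, y i ∈ closedBall (xb i) δ0) →
      Function.Injective y → y ≠ xb → KR xb < KR y)
    (ψ : (E2 → ℝ) → E2 → ℝ)
    (hψ : ∀ ω x, ψ ω x = ∫ y in D, G x y * ω y)
    (En : (E2 → ℝ) → ℝ)
    (hEn : ∀ ω, En ω = (1 / 2) * ∫ x in D, ∫ y in D, G x y * ω x * ω y)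
    (EE : (E2 → ℝ) → (Fin l → E2) → ℝ)
    (hEE : ∀ ω z, EE ω z = En ω
      + ∑ j, κ (Fin.natAdd p j) * ψ ω (z j)
      + (1 / 2) * ∑ i, ∑ j ∈ Finset.univ.filter (fun j => j ≠ i),
          κ (Fin.natAdd p i) * κ (Fin.natAdd p j) * G (z i) (z j)
      - ∑ j, (κ (Fin.natAdd p j)) ^ 2 * ((1 / 2) * h (z j) (z j)))
    (Adm : ℝ → ℝ → (Fin p → E2 → ℝ) → Prop)
    (hAdm : ∀ δ lam ωs, Adm δ lam ωs ↔ ∀ i : Fin p,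
      Measurable (ωs i)
      ∧ (∀ x, x ∉ ball (xb (Fin.castAdd l i)) δ → ωs i x = 0)
      ∧ (∫ x in D, ωs i x) = κ (Fin.castAdd l i)
      ∧ (∀ᵐ x : E2 ∂volume, 0 ≤ Real.sign (κ (Fin.castAdd l i)) * ωs i x
          ∧ Real.sign (κ (Fin.castAdd l i)) * ωs i x ≤ lam))
    (lam : ℝ) (hlam : 0 < lam) (δ : ℝ) (hδ : 0 < δ) (hδ2 : δ < δ0 / 2)
    (ωs : Fin p → E2 → ℝ) (z : Fin l → E2)
    (hmax : Adm δ lam ωs ∧ (∀ j, z j ∈ closedBall (xb (Fin.natAdd p j)) δ) ∧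
      (∀ (ωs' : Fin p → E2 → ℝ) (z' : Fin l → E2), Adm δ lam ωs' →
        (∀ j, z' j ∈ closedBall (xb (Fin.natAdd p j)) δ) →
        EE (∑ i, ωs' i) z' ≤ EE (∑ i, ωs i) z))
    :
    ∀ i : Fin p, ∃ c : ℝ,
      (ωs i =ᵐ[volume]
        Set.indicator
          ({x ∈ D | c < Real.sign (κ (Fin.castAdd l i)) * (ψ (∑ i', ωs i') x + ∑ j, κ (Fin.natAdd p j) * G (z j) x)} ∩ ball (xb (Fin.castAdd l i)) δ)
          (fun _ => Real.sign (κ (Fin.castAdd l i)) * lam)) ∧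
      c = essInf (fun x => Real.sign (κ (Fin.castAdd l i)) * (ψ (∑ i', ωs i') x + ∑ j, κ (Fin.natAdd p j) * G (z j) x))
        (volume.restrict {x ∈ ball (xb (Fin.castAdd l i)) δ | 0 < Real.sign (κ (Fin.castAdd l i)) * ωs i x}) := by
  classical
  intro i
  obtain ⟨hA, hz, hopt⟩ := hmax
  have hδδ0 : δ < δ0 := by linarith
  set K : Set E2 := ⋃ j, closedBall (xb j) δ
  have hballK : ∀ j, closedBall (xb j) δ ⊆ K := fun j =>
    Set.subset_iUnion (fun j => closedBall (xb j) δ) j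
  have hKc : IsCompact K := isCompact_iUnion fun j => isCompact_closedBall _ _
  have hKD : K ⊆ D := Set.iUnion_subset fun j =>
    (closedBall_subset_closedBall hδδ0.le).trans (hball j)
  have hDm := hDopen.measurableSet
  have hh : ContinuousOn (Function.uncurry h) (K ×ˢ K) := hcont.mono (Set.prod_mono hKD hKD)
  have hGs : ∀ x ∈ K, ∀ y ∈ K, G x y = G y x := fun x hx y hy => by
    rw [hG, hG, dist_comm, hsymm x (hKD hx) y (hKD hy)]
  set N := truncatedKernel K G with hN
  have hNm : Measurable (Function.uncurry N) := measurable_truncatedKernel hKc hh hG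
  obtain ⟨g, hg, hNg⟩ := exists_integrable_bound_truncatedKernel hKc hh hG
  have hNs : ∀ x y, N x y = N y x := truncatedKernel_comm hGs
  obtain ⟨M, hM⟩ := exists_bound_truncatedKernel hKc hh hG (sub_pos.2 hδδ0)
  have hzK : ∀ j, z j ∈ K := fun j => hballK _ (hz j)
  have hdisjB : ∀ j j' : Fin p, j ≠ j' →
      Disjoint (ball (xb (Fin.castAdd l j)) δ) (ball (xb (Fin.castAdd l j')) δ) := fun j j' hj =>
    (hdisj _ _ fun h => hj (Fin.castAdd_injective p l h)).mono
      (ball_subset_closedBall.trans (closedBall_subset_closedBall hδδ0.le))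
      (ball_subset_closedBall.trans (closedBall_subset_closedBall hδδ0.le))
  have hadm : ∀ ωs', Adm δ lam ωs' → Measurable (∑ j, ωs' j) ∧
      (∀ᵐ x, |(∑ j, ωs' j) x| ≤ lam) ∧ ∀ x, x ∉ K → (∑ j, ωs' j) x = 0 := by
    intro ωs' hω'
    rw [hAdm] at hω'
    refine ⟨by simpa only [Finset.sum_fn] using Finset.measurable_fun_sum _ fun j _ => (hω' j).1,
      ae_abs_sum_le hdisjB hlam.le (fun j => (hω' j).2.1) fun j =>
        (hω' j).2.2.2.mono fun x hx => abs_le_of_sign_mul (hκ _) hx,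
      fun x hx => sum_apply_eq_zero (fun j => (hω' j).2.1) fun j hj =>
        hx (hballK _ (ball_subset_closedBall hj))⟩
  obtain ⟨hωm, hωb, hωK⟩ := hadm ωs hA
  set b : E2 → ℝ := fun x => ∑ j, κ (Fin.natAdd p j) * N (z j) x with hb
  have hbm : Measurable b := Finset.measurable_fun_sum _ fun j _ =>
    (hNm.of_uncurry_left).const_mul _
  have hbexp : ∀ u : E2 → ℝ, (fun x => b x * u x) =
      fun x => ∑ j, κ (Fin.natAdd p j) * (N (z j) x * u x) := fun u => funext fun x => by
    simp only [hb, Finset.sum_mul, mul_assoc]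
  have hbi : ∀ u : E2 → ℝ, Measurable u → (∀ᵐ x, |u x| ≤ lam) →
      Integrable fun x => b x * u x := fun u hum hub => by
    rw [hbexp]
    exact integrable_finsetSum _ fun j _ =>
      (integrable_kernel_mul hNm hg hNg hum hub (z j)).const_mul _
  have henergy : ∃ c : ℝ, ∀ u : E2 → ℝ, Measurable u → (∀ᵐ x, |u x| ≤ lam) →
      (∀ x, x ∉ K → u x = 0) →
      EE u z = 1 / 2 * (∫ x, u x * ∫ y, N x y * u y) + (∫ x, b x * u x) + c := by
    refine ⟨(1 / 2) * ∑ i, ∑ j ∈ Finset.univ.filter (fun j => j ≠ i),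
        κ (Fin.natAdd p i) * κ (Fin.natAdd p j) * G (z i) (z j) -
      ∑ j, (κ (Fin.natAdd p j)) ^ 2 * ((1 / 2) * h (z j) (z j)), fun u hum hub huK => ?_⟩
    have h1 : ∫ x, b x * u x = ∑ j, κ (Fin.natAdd p j) * ψ u (z j) := by
      rw [hbexp, integral_finsetSum _ fun j _ =>
        (integrable_kernel_mul hNm hg hNg hum hub (z j)).const_mul _]
      refine Finset.sum_congr rfl fun j _ => ?_
      rw [integral_const_mul, hψ, setIntegral_kernel_mul_eq hDm hKD huK (hzK j)]
    rw [hEE, hEn, setIntegral_energy_eq hDm hKD huK, ← h1, add_sub_assoc]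
  obtain ⟨e, he⟩ := henergy
  set s := Real.sign (κ (Fin.castAdd l i)) with hs
  have hss : s * s = 1 := sign_mul_sign_self (hκ _)
  set B := ball (xb (Fin.castAdd l i)) δ
  have hBK : B ⊆ K := ball_subset_closedBall.trans (hballK _)
  have hA' := (hAdm δ lam ωs).1 hA
  have hωB : ∀ x ∈ B, (∑ j, ωs j) x = ωs i x := fun x hx =>
    sum_apply_eq_of_mem hdisjB (fun j => (hA' j).2.1) hx
  have hBz : ∀ x ∈ B, ∀ j, δ0 - δ ≤ dist (z j) x := by
    intro x hx j
    by_contra hlt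
    rw [not_le] at hlt
    have hne : Fin.castAdd l i ≠ Fin.natAdd p j := fun heq => by
      have := congrArg Fin.val heq
      simp only [Fin.val_castAdd, Fin.val_natAdd] at this
      omega
    refine (hdisj _ _ hne).notMem_of_mem_left
      (closedBall_subset_closedBall hδδ0.le (ball_subset_closedBall hx)) ?_
    have h1 := mem_closedBall.1 (hz j)
    have h2 := dist_triangle x (z j) (xb (Fin.natAdd p j))
    rw [dist_comm x (z j)] at h2
    rw [mem_closedBall]
    linarith
  have hzB : ∀ j, z j ∉ B := fun j hj => by
    have := hBz _ hj j
    rw [dist_self] at this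
    linarith
  have hNi : ∀ w, Integrable fun u => N u w := fun w =>
    (hg.comp_sub_right w).mono' hNm.of_uncurry_right.aestronglyMeasurable
      (.of_forall fun u => hNg u w)
  have hdef : ∀ y r, 0 < r → closedBall y r ⊆ B → ∀ w ∈ K, y ≠ w →
      ∫ u in closedBall y r, (N y w - N u w) = logDeficit r (dist y w) := by
    intro y r hr hyr w hw hyw
    obtain ⟨hc, hlap⟩ := hharm w (hKD hw)
    refine setIntegral_closedBall_greenKernel (k := fun u => N u w) hNm.of_uncurry_right hDopen hc
      hlap hyw hr (hyr.trans (hBK.trans hKD)) (hNi w).integrableOn fun u hu => ?_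
    simp only [hN]
    rw [truncatedKernel_of_mem (hBK (hyr hu)) hw, hG]
  have hbdef : ∀ y r, 0 < r → closedBall y r ⊆ B → ∫ u in closedBall y r, (b y - b u) = 0 := by
    intro y r hr hyr
    have h1 : ∀ u, b y - b u = ∑ j, κ (Fin.natAdd p j) * (N y (z j) - N u (z j)) := fun u => by
      simp only [hb, ← Finset.sum_sub_distrib, mul_sub, hNs (z _)]
    simp only [h1]
    have hc : ∀ a : ℝ, IntegrableOn (fun _ : E2 => a) (closedBall y r) := fun a =>
      integrableOn_const measure_closedBall_lt_top.ne
    rw [integral_finsetSum _ fun j _ => by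
      exact ((hc _).sub (hNi (z j)).integrableOn).const_mul _]
    refine Finset.sum_eq_zero fun j _ => ?_
    have hrz : r < dist y (z j) := by
      by_contra hle
      exact hzB j (hyr (by rwa [mem_closedBall, dist_comm, ← not_lt]))
    rw [integral_const_mul, hdef y r hr hyr _ (hzK j) (dist_pos.1 (hr.trans hrz)),
      logDeficit_eq_zero (hr.trans hrz) hrz.le, mul_zero]
  have hbB : ∀ x ∈ B, |b x| ≤ ∑ j, |κ (Fin.natAdd p j)| * M := fun x hx =>
    (Finset.abs_sum_le_sum_abs _ _).trans (Finset.sum_le_sum fun j _ => by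
      rw [abs_mul]
      exact mul_le_mul_of_nonneg_left (hM _ _ (hBz x hx j)) (abs_nonneg _))
  have hωiI : ∀ j, Integrable (ωs j) := fun j =>
    integrable_of_ae_bounded_of_eq_zero measure_ball_lt_top.ne (hA' j).1
      ((hA' j).2.2.2.mono fun x hx => abs_le_of_sign_mul (hκ _) hx) (hA' j).2.1
  have hpos : 0 < ∫ x in B, s * (∑ j, ωs j) x := by
    have h1 : ∫ x in B, s * (∑ j, ωs j) x = s * κ (Fin.castAdd l i) := by
      rw [integral_const_mul, setIntegral_congr_fun measurableSet_ball hωB, ← (hA' i).2.2.1,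
        setIntegral_eq_integral_of_forall_compl_eq_zero (hA' i).2.1,
        setIntegral_eq_integral_of_forall_compl_eq_zero fun x hx =>
          (hA' i).2.1 x fun hxB => hx (hKD (hBK hxB))]
    rw [h1]
    rcases (hκ (Fin.castAdd l i)).lt_or_gt with h2 | h2
    · rw [hs, sign_of_neg h2]
      linarith
    · rw [hs, sign_of_pos h2]
      linarith
  have hmain := ae_eq_ite_of_kernel_energy_max hNm hg hNg hNs (ω := ∑ j, ωs j) (K := K) (B := B)
    hss hlam.le hωm hωb
    (integrable_of_ae_bounded_of_eq_zero hKc.measure_lt_top.ne hωm hωb hωK) hωK isOpen_ball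
    measure_ball_lt_top.ne
    ((hA' i).2.2.2.mono fun x hx hxB => by rw [hωB x hxB]; exact hx) hpos hbm hbB hbi hdef hbdef
    (by
      intro η hηm hηi hηB hη0 hηv
      have hadm' : Adm δ lam (ωs + Pi.single i η) := by
        refine (hAdm _ _ _).2 fun j => ?_
        rcases eq_or_ne j i with rfl | hj
        · rw [Pi.add_apply, Pi.single_eq_same]
          refine ⟨(hA' j).1.add hηm, fun x hx => ?_, ?_, ?_⟩
          · rw [Pi.add_apply, (hA' j).2.1 x hx, hηB x hx, add_zero]
          · simp only [Pi.add_apply]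
            rw [integral_add (hωiI j).integrableOn hηi.integrableOn, (hA' j).2.2.1,
              setIntegral_eq_integral_of_forall_compl_eq_zero fun x hx =>
                hηB x fun hxB => hx (hKD (hBK hxB)), hη0, add_zero]
          · filter_upwards [hηv] with x hx
            by_cases hxB : x ∈ B
            · rw [Pi.add_apply, ← hωB x hxB]
              exact hx hxB
            · rw [Pi.add_apply, (hA' j).2.1 x hxB, hηB x hxB, add_zero, mul_zero]
              exact ⟨le_rfl, hlam.le⟩
        · rw [Pi.add_apply, Pi.single_eq_of_ne hj, add_zero]
          exact hA' j
      have hsum : ∑ j, (ωs + Pi.single i η : Fin p → E2 → ℝ) j = ∑ j, ωs j + η := by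
        have h1 : ∑ j, (Pi.single i η : Fin p → E2 → ℝ) j = η :=
          (Finset.sum_eq_single i (fun j _ hj => Pi.single_eq_of_ne hj _) (by simp)).trans
            (by rw [Pi.single_eq_same])
        simp only [Pi.add_apply, Finset.sum_add_distrib, h1]
      obtain ⟨h1, h2, h3⟩ := hadm _ hadm'
      have h4 := hopt _ z hadm' hz
      rw [he _ h1 h2 h3, he _ hωm hωb hωK, hsum] at h4
      simp only [Pi.add_apply] at h4
      linarith)
  have hΦ : ∀ x ∈ B, s * (ψ (∑ j, ωs j) x + ∑ j, κ (Fin.natAdd p j) * G (z j) x) =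
      s * ((∫ y, N x y * (∑ j, ωs j) y) + b x) := fun x hx => by
    rw [hψ, setIntegral_kernel_mul_eq hDm hKD hωK (hBK hx)]
    simp only [hb, hN, truncatedKernel_of_mem (hzK _) (hBK hx)]
  have hset : {x ∈ B | 0 < s * (∑ j, ωs j) x} = {x ∈ B | 0 < s * ωs i x} :=
    Set.ext fun x => and_congr_right fun hx => by rw [hωB x hx]
  have hsetm : MeasurableSet {x ∈ B | 0 < s * ωs i x} :=
    measurableSet_ball.inter (measurableSet_lt measurable_const ((hA' i).1.const_mul s))
  have hess : essInf (fun x => s * (ψ (∑ j, ωs j) x + ∑ j, κ (Fin.natAdd p j) * G (z j) x))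
      (volume.restrict {x ∈ B | 0 < s * ωs i x}) =
      essInf (fun x => s * ((∫ y, N x y * (∑ j, ωs j) y) + b x))
        (volume.restrict {x ∈ B | 0 < s * ωs i x}) :=
    essInf_congr_ae ((ae_restrict_mem hsetm).mono fun x hx => hΦ x hx.1)
  refine ⟨_, ?_, rfl⟩
  rw [hset, ← hess] at hmain
  filter_upwards [hmain] with x hx
  by_cases hxB : x ∈ B
  · have h1 := hx hxB
    rw [hωB x hxB, ← hΦ x hxB] at h1
    have h2 : ωs i x = s * (s * ωs i x) := by rw [← mul_assoc, hss, one_mul]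
    rw [h2, h1]
    split_ifs with hc
    · rw [Set.indicator_of_mem (by exact ⟨⟨hKD (hBK hxB), hc⟩, hxB⟩)]
    · rw [Set.indicator_of_notMem fun hm => hc hm.1.2, mul_zero]
  · rw [(hA' i).2.1 x hxB, Set.indicator_of_notMem fun hm => hxB hm.2]
end
end

section
/- Lower bound for the Lagrange-multiplier levels: there exists C > 0, independent of λ and of δ, such that for every λ > 0, every δ ∈ (0, δ0/2), every maximizer (ω^λ, x_{p+1}^λ, …, x_k^λ) of ℰ over N_p^λ × B̄_δ(x̄_{p+1}) × ⋯ × B̄_δ(x̄_k), and every i ∈ {1,…,p}, the level c_i^λ satisfies c_i^λ ≥ −(|κ_i|/2π)·ln δ − C. -/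
open MeasureTheory Metric Real Filter Topology

noncomputable section

theorem le_essInf_of_ae_le_real {α : Type*} [MeasurableSpace α] {μ : Measure α} (hμ : μ ≠ 0)
    {f : α → ℝ} {c : ℝ} (hf : ∀ᵐ x ∂μ, c ≤ f x) : c ≤ essInf f μ := by
  obtain ⟨n, hn⟩ : ∃ n : ℕ, μ {x | f x ≤ n} ≠ 0 := by
    by_contra! hzero
    refine hμ (Measure.measure_univ_eq_zero.mp (measure_mono_null ?_ (measure_iUnion_null hzero)))
    intro x _
    obtain ⟨n, hn⟩ := exists_nat_ge (f x)
    exact Set.mem_iUnion.mpr ⟨n, hn⟩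
  refine le_csSup ⟨n, fun a ha => ?_⟩ hf
  by_contra! hlt
  refine hn (measure_mono_null ?_ (ae_iff.mp (mem_map.mp ha : ∀ᵐ x ∂μ, a ≤ f x)))
  intro x (hx : f x ≤ n)
  exact not_le.mpr (hx.trans_lt hlt)

theorem integrableOn_log_dist_ball (x : E2) (r : ℝ) :
    IntegrableOn (fun y => Real.log (1 / dist x y)) (ball x r) := by
  have hball : IntegrableOn (fun y : E2 => Real.log ‖y‖) (ball 0 r) := by
    rw [integrableOn_fun_norm_addHaar volume (f := Real.log)]
    have hdim : Module.finrank ℝ E2 - 1 = 1 := by simp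
    rw [hdim]
    refine IntegrableOn.mono_set (t := Set.Icc 0 r) ?_ Set.Ioo_subset_Icc_self
    refine ContinuousOn.integrableOn_Icc ?_
    simpa using Real.continuous_mul_log.continuousOn
  have hmp := measurePreserving_sub_right (volume : Measure E2) x
  have hpre : (fun y => y - x) ⁻¹' (ball (0 : E2) r) = ball x r := by
    ext y
    simp [dist_eq_norm]
  have hshift := (hmp.integrableOn_comp_preimage
    (MeasurableEquiv.subRight x).measurableEmbedding).mpr hball
  rw [hpre] at hshift
  refine hshift.neg.congr (Eventually.of_forall fun y => ?_)
  simp [dist_eq_norm, norm_sub_rev x y]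

/-- A bounded function on the plane, vanishing off a ball, is integrable against the sum of a
logarithmic kernel and a function continuous on the closed ball. -/
theorem integrable_log_sub_mul {x c : E2} {r M : ℝ} {g w : E2 → ℝ}
    (hg : ContinuousOn g (closedBall c r)) (hw : Measurable w)
    (hw0 : ∀ y, y ∉ ball c r → w y = 0) (hwM : ∀ᵐ y : E2, |w y| ≤ M) :
    Integrable (fun y => ((1 / (2 * π)) * Real.log (1 / dist x y) - g y) * w y) := by
  rw [← integrableOn_iff_integrable_of_support_subset (s := ball c r)]
  · refine Integrable.mul_bdd (c := M) ?_ hw.aestronglyMeasurable (ae_restrict_of_ae hwM)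
    refine Integrable.sub (Integrable.const_mul ?_ _) ?_
    · refine (integrableOn_log_dist_ball x (r + dist c x)).mono_set ?_
      exact ball_subset_ball' le_rfl
    · exact (hg.integrableOn_compact (isCompact_closedBall c r)).mono_set ball_subset_closedBall
  · intro y hy
    by_contra hyc
    exact hy (by simp [hw0 y hyc])

theorem mul_integral_le_integral_mul {α : Type*} [MeasurableSpace α] {μ : Measure α}
    {s : Set α} {F w : α → ℝ} {a : ℝ} (hw0 : ∀ y, y ∉ s → w y = 0)
    (hw : ∀ᵐ y ∂μ, 0 ≤ w y) (hF : ∀ᵐ y ∂μ, y ∈ s → a ≤ F y) (hint : Integrable w μ)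
    (hFint : Integrable (fun y => F y * w y) μ) :
    a * ∫ y, w y ∂μ ≤ ∫ y, F y * w y ∂μ := by
  rw [← integral_const_mul]
  refine integral_mono_ae (hint.const_mul a) hFint ?_
  filter_upwards [hw, hF] with y hwy hFy
  by_cases hy : y ∈ s
  · exact mul_le_mul_of_nonneg_right (hFy hy) hwy
  · simp [hw0 y hy]

theorem abs_log_one_div_le {a b t : ℝ} (ha : 0 < a) (hat : a ≤ t) (htb : t ≤ b) :
    |Real.log (1 / t)| ≤ |Real.log a| + |Real.log b| := by
  have h1 := Real.log_le_log ha hat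
  have h2 := Real.log_le_log (ha.trans_le hat) htb
  rw [one_div, Real.log_inv, abs_neg, abs_le]
  constructor
  · linarith [neg_abs_le (Real.log a), abs_nonneg (Real.log b)]
  · linarith [le_abs_self (Real.log b), abs_nonneg (Real.log a)]

theorem Real.sign_mul_self_eq_abs (t : ℝ) : Real.sign t * t = |t| := by
  rcases lt_trichotomy t 0 with ht | rfl | ht
  · rw [Real.sign_of_neg ht, abs_of_neg ht, neg_one_mul]
  · simp
  · rw [Real.sign_of_pos ht, abs_of_pos ht, one_mul]

theorem Real.abs_sign_of_ne_zero {t : ℝ} (ht : t ≠ 0) : |Real.sign t| = 1 := by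
  rcases Real.sign_apply_eq_of_ne_zero t ht with hs | hs <;> simp [hs]

theorem level_lower_bound
    (p l : ℕ) (hp : 0 < p) (hl : 0 < l)
    (D : Set E2) (hDopen : IsOpen D) (hDbdd : Bornology.IsBounded D)
    (hDsc : SimplyConnectedSpace D)
    (h : E2 → E2 → ℝ)
    (hcont : ContinuousOn (fun q : E2 × E2 => h q.1 q.2) (D ×ˢ D))
    (hsymm : ∀ x ∈ D, ∀ y ∈ D, h x y = h y x)
    (hharm : ∀ y ∈ D, ContDiffOn ℝ 2 (fun x => h x y) D ∧
      ∀ x ∈ D, ∑ i : Fin 2,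
        iteratedFDerivWithin ℝ 2 (fun x' => h x' y) D x
          ![EuclideanSpace.single i 1, EuclideanSpace.single i 1] = 0)
    (G : E2 → E2 → ℝ)
    (hG : ∀ x y, G x y = (1 / (2 * π)) * Real.log (1 / dist x y) - h x y)
    (hGbdry : ∀ y ∈ D, ∀ z ∈ frontier D,
      Tendsto (fun x => G x y) (𝓝[D] z) (𝓝 0))
    (κ : Fin (p + l) → ℝ) (hκ : ∀ i, κ i ≠ 0)
    (xb : Fin (p + l) → E2) (hxbD : ∀ i, xb i ∈ D) (hxbinj : Function.Injective xb)
    (δ0 : ℝ) (hδ0 : 0 < δ0)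
    (hball : ∀ i, closedBall (xb i) δ0 ⊆ D)
    (hdisj : ∀ i j, i ≠ j → Disjoint (closedBall (xb i) δ0) (closedBall (xb j) δ0))
    (KR : (Fin (p + l) → E2) → ℝ)
    (hKR : ∀ y, KR y =
      -(∑ i, ∑ j ∈ Finset.univ.filter (fun j => j ≠ i), κ i * κ j * G (y i) (y j))
      + ∑ i, (κ i) ^ 2 * h (y i) (y i))
    (hmin : ∀ y : Fin (p + l) → E2, (∀ i, y i ∈ closedBall (xb i) δ0) →
      Function.Injective y → y ≠ xb → KR xb < KR y)
    (ψ : (E2 → ℝ) → E2 → ℝ)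
    (hψ : ∀ ω x, ψ ω x = ∫ y in D, G x y * ω y)
    (En : (E2 → ℝ) → ℝ)
    (hEn : ∀ ω, En ω = (1 / 2) * ∫ x in D, ∫ y in D, G x y * ω x * ω y)
    (EE : (E2 → ℝ) → (Fin l → E2) → ℝ)
    (hEE : ∀ ω z, EE ω z = En ω
      + ∑ j, κ (Fin.natAdd p j) * ψ ω (z j)
      + (1 / 2) * ∑ i, ∑ j ∈ Finset.univ.filter (fun j => j ≠ i),
          κ (Fin.natAdd p i) * κ (Fin.natAdd p j) * G (z i) (z j)
      - ∑ j, (κ (Fin.natAdd p j)) ^ 2 * ((1 / 2) * h (z j) (z j)))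
    (Adm : ℝ → ℝ → (Fin p → E2 → ℝ) → Prop)
    (hAdm : ∀ δ lam ωs, Adm δ lam ωs ↔ ∀ i : Fin p,
      Measurable (ωs i)
      ∧ (∀ x, x ∉ ball (xb (Fin.castAdd l i)) δ → ωs i x = 0)
      ∧ (∫ x in D, ωs i x) = κ (Fin.castAdd l i)
      ∧ (∀ᵐ x : E2 ∂volume, 0 ≤ Real.sign (κ (Fin.castAdd l i)) * ωs i x
          ∧ Real.sign (κ (Fin.castAdd l i)) * ωs i x ≤ lam))
    :
    ∃ C > 0, ∀ lam, 0 < lam → ∀ δ, 0 < δ → δ < δ0 / 2 →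
      ∀ (ωs : Fin p → E2 → ℝ) (z : Fin l → E2),
      (Adm δ lam ωs ∧ (∀ j, z j ∈ closedBall (xb (Fin.natAdd p j)) δ) ∧
      (∀ (ωs' : Fin p → E2 → ℝ) (z' : Fin l → E2), Adm δ lam ωs' →
        (∀ j, z' j ∈ closedBall (xb (Fin.natAdd p j)) δ) →
        EE (∑ i, ωs' i) z' ≤ EE (∑ i, ωs i) z)) →
      ∀ i : Fin p,
        -(|κ (Fin.castAdd l i)| / (2 * π)) * Real.log δ - C ≤
          essInf (fun x => Real.sign (κ (Fin.castAdd l i)) * (ψ (∑ i', ωs i') x + ∑ j, κ (Fin.natAdd p j) * G (z j) x))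
        (volume.restrict {x ∈ ball (xb (Fin.castAdd l i)) δ | 0 < Real.sign (κ (Fin.castAdd l i)) * ωs i x}) := by
  have hhc : ∀ x ∈ D, ContinuousOn (h x) D := fun x hx =>
    hcont.comp (f := fun y => (x, y)) (by fun_prop) fun y hy => ⟨hx, hy⟩
  set K : Set E2 := ⋃ i, closedBall (xb i) δ0
  have hKc : IsCompact K := isCompact_iUnion fun i => isCompact_closedBall _ _
  have hKD : K ⊆ D := Set.iUnion_subset hball
  have hmemK : ∀ i, ∀ x ∈ closedBall (xb i) δ0, x ∈ K := fun i x hx => Set.mem_iUnion.mpr ⟨i, hx⟩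
  obtain ⟨M, hM⟩ := (hKc.prod hKc).exists_bound_of_continuousOn
    (hcont.mono (Set.prod_mono hKD hKD))
  have hMh : ∀ x ∈ K, ∀ y ∈ K, |h x y| ≤ M := fun x hx y hy => hM (x, y) ⟨hx, hy⟩
  obtain ⟨R, hR⟩ := Metric.isBounded_iff.mp hKc.isBounded
  set A : ℝ := (1 / (2 * π)) * (|Real.log (δ0 / 2)| + |Real.log R|) + M with hA
  have hGcross : ∀ i j, i ≠ j → ∀ x ∈ closedBall (xb i) (δ0 / 2),
      ∀ y ∈ closedBall (xb j) (δ0 / 2), |G x y| ≤ A := by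
    intro i j hij x hx y hy
    have hle : δ0 / 2 ≤ δ0 := by linarith
    have hxi := closedBall_subset_closedBall hle hx
    have hyj := closedBall_subset_closedBall hle hy
    have hdist : δ0 / 2 ≤ dist x y := by
      by_contra! hlt
      refine Set.disjoint_left.mp (hdisj i j hij) ?_ hyj
      rw [mem_closedBall] at hx ⊢
      linarith [dist_triangle y x (xb i), dist_comm x y]
    have hlog := abs_log_one_div_le (by positivity) hdist
      (hR (hmemK i x hxi) (hmemK j y hyj))
    rw [hG, hA]
    refine (abs_sub _ _).trans (add_le_add ?_ (hMh x (hmemK i x hxi) y (hmemK j y hyj)))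
    rw [abs_mul, abs_of_pos (by positivity : (0 : ℝ) < 1 / (2 * π))]
    exact mul_le_mul_of_nonneg_left hlog (by positivity)
  have hi0 := hmemK (Fin.castAdd l ⟨0, hp⟩) _ (mem_closedBall_self hδ0.le)
  have hM0 : 0 ≤ M := (abs_nonneg _).trans (hMh _ hi0 _ hi0)
  have hA0 : 0 ≤ A := by positivity
  set B : ℝ := (1 / (2 * π)) * Real.log 2 + M with hB
  have hB0 : 0 ≤ B := by positivity
  set S : ℝ := ∑ i, |κ i| with hS
  have hS0 : 0 ≤ S := Finset.sum_nonneg fun i _ => abs_nonneg _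
  refine ⟨B * S + A * S + 1, by positivity, ?_⟩
  rintro lam hlam δ hδ hδδ0 ωs z ⟨hadm, hz, -⟩ i
  rw [hAdm] at hadm
  set s : Fin p → ℝ := fun i' => Real.sign (κ (Fin.castAdd l i')) with hs
  have hsabs : ∀ i', |s i'| = 1 := fun i' => Real.abs_sign_of_ne_zero (hκ _)
  have hss : ∀ i', s i' * s i' = 1 := fun i' => by
    rw [← abs_mul_abs_self, hsabs, one_mul]
  have hsub : ∀ j, closedBall (xb j) δ ⊆ closedBall (xb j) (δ0 / 2) := fun j =>
    closedBall_subset_closedBall hδδ0.le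
  have hsub' : ∀ j, closedBall (xb j) δ ⊆ closedBall (xb j) δ0 := fun j =>
    closedBall_subset_closedBall (by linarith)
  have hωD : ∀ i', ∀ y, y ∉ D → ωs i' y = 0 := fun i' y hy =>
    (hadm i').2.1 y fun hyb => hy (hball _ (hsub' _ (ball_subset_closedBall hyb)))
  have hωbdd : ∀ i', ∀ᵐ y : E2, |ωs i' y| ≤ lam := by
    intro i'
    filter_upwards [(hadm i').2.2.2] with y hy
    calc |ωs i' y| = |s i' * ωs i' y| := by rw [abs_mul, hsabs, one_mul]
      _ ≤ lam := by rw [abs_of_nonneg hy.1]; exact hy.2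
  have hωint : ∀ i', Integrable (ωs i') := by
    intro i'
    rw [← integrableOn_iff_integrable_of_support_subset (s := ball (xb (Fin.castAdd l i')) δ)]
    · exact Measure.integrableOn_of_bounded measure_ball_lt_top.ne
        (hadm i').1.aestronglyMeasurable (ae_restrict_of_ae (hωbdd i'))
    · intro y hy
      by_contra hyc
      exact hy ((hadm i').2.1 y hyc)
  have hmass : ∀ i', ∫ y, s i' * ωs i' y = |κ (Fin.castAdd l i')| := by
    intro i'
    rw [integral_const_mul, ← setIntegral_eq_integral_of_forall_compl_eq_zero (hωD i'),
      (hadm i').2.2.1, hs, Real.sign_mul_self_eq_abs]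
  have hGint : ∀ x ∈ D, ∀ i', Integrable fun y => G x y * ωs i' y := by
    intro x hx i'
    simp only [hG]
    exact integrable_log_sub_mul ((hhc x hx).mono ((hsub' _).trans (hball _))) (hadm i').1
      (hadm i').2.1 (hωbdd i')
  have hψsum : ∀ x ∈ D, ψ (∑ i', ωs i') x = ∑ i', ∫ y, G x y * ωs i' y := by
    intro x hx
    rw [hψ, setIntegral_eq_integral_of_forall_compl_eq_zero,
      ← integral_finsetSum _ fun i' _ => hGint x hx i']
    · simp only [Finset.sum_apply, Finset.mul_sum]
    · intro y hy
      simp [hωD _ y hy]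
  have hcomp : ∀ x ∈ D, ∀ (i' : Fin p) (a : ℝ),
      (∀ᵐ y : E2, y ∈ ball (xb (Fin.castAdd l i')) δ → a ≤ s i * s i' * G x y) →
      a * |κ (Fin.castAdd l i')| ≤ s i * ∫ y, G x y * ωs i' y := by
    intro x hx i' a ha
    have hprod : ∀ y, s i * s i' * G x y * (s i' * ωs i' y) = s i * (G x y * ωs i' y) := by
      intro y
      linear_combination (s i * G x y * ωs i' y) * hss i'
    have hle := mul_integral_le_integral_mul (μ := volume) (w := fun y => s i' * ωs i' y)
      (fun y hy => by simp [(hadm i').2.1 y hy]) ((hadm i').2.2.2.mono fun y hy => hy.1) ha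
      ((hωint i').const_mul _) (by simpa only [hprod] using (hGint x hx i').const_mul (s i))
    simpa only [hprod, hmass, integral_const_mul] using hle
  have hμ : volume.restrict {x ∈ ball (xb (Fin.castAdd l i)) δ | 0 < s i * ωs i x} ≠ 0 := by
    rw [Ne, Measure.restrict_eq_zero]
    intro hnull
    have hzero : ∫ y, s i * ωs i y = 0 := by
      refine integral_eq_zero_of_ae ?_
      filter_upwards [(hadm i).2.2.2, measure_eq_zero_iff_ae_notMem.mp hnull] with y hy hyn
      by_cases hyb : y ∈ ball (xb (Fin.castAdd l i)) δ
      · exact le_antisymm (not_lt.mp fun hpos => hyn ⟨hyb, hpos⟩) hy.1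
      · simp [(hadm i).2.1 y hyb]
    rw [hmass] at hzero
    exact hκ _ (abs_eq_zero.mp hzero)
  refine le_essInf_of_ae_le_real hμ ?_
  have hset : MeasurableSet {x ∈ ball (xb (Fin.castAdd l i)) δ | 0 < s i * ωs i x} :=
    measurableSet_ball.inter (measurableSet_lt measurable_const ((hadm i).1.const_mul _))
  refine (ae_restrict_iff' hset).mpr (Eventually.of_forall fun x hx => ?_)
  have hxb : x ∈ ball (xb (Fin.castAdd l i)) δ := hx.1
  have hxc := ball_subset_closedBall hxb
  have hxK := hmemK _ x (hsub' _ hxc)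
  have hxD := hKD hxK
  have hself : (-(1 / (2 * π)) * Real.log δ - B) * |κ (Fin.castAdd l i)| ≤
      s i * ∫ y, G x y * ωs i y := by
    refine hcomp x hxD i _ ?_
    have hne : ∀ᵐ y : E2, y ≠ x := by simp [ae_iff]
    filter_upwards [hne] with y hyx hyb
    have hdpos : 0 < dist x y := dist_pos.mpr hyx.symm
    have hdle : dist x y ≤ 2 * δ := by
      rw [mem_ball] at hxb hyb
      linarith [dist_triangle_right x y (xb (Fin.castAdd l i))]
    have hlog := Real.log_le_log hdpos hdle
    rw [Real.log_mul two_ne_zero hδ.ne'] at hlog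
    have hhM := (abs_le.mp
      (hMh x hxK y (hmemK _ y (hsub' _ (ball_subset_closedBall hyb))))).2
    have hscaled := mul_le_mul_of_nonneg_left hlog (by positivity : (0 : ℝ) ≤ 1 / (2 * π))
    rw [hss, one_mul, hG, one_div (dist x y), Real.log_inv, hB]
    linarith
  have hother : ∀ i', i' ≠ i → -A * |κ (Fin.castAdd l i')| ≤ s i * ∫ y, G x y * ωs i' y := by
    intro i' hi'
    refine hcomp x hxD i' _ (Eventually.of_forall fun y hyb => ?_)
    have hne : Fin.castAdd l i ≠ Fin.castAdd l i' := fun he =>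
      hi' (Fin.castAdd_injective p l he).symm
    have hGA := hGcross _ _ hne x (hsub _ hxc) y (hsub _ (ball_subset_closedBall hyb))
    refine (abs_le.mp ?_).1
    rwa [abs_mul, abs_mul, hsabs, hsabs, one_mul, one_mul]
  have hpoint : ∀ j, -A * |κ (Fin.natAdd p j)| ≤ s i * (κ (Fin.natAdd p j) * G (z j) x) := by
    intro j
    have hne : Fin.natAdd p j ≠ Fin.castAdd l i := by
      intro he
      have := congrArg Fin.val he
      simp only [Fin.val_natAdd, Fin.val_castAdd] at this
      omega
    have hGA := hGcross _ _ hne (z j) (hsub _ (hz j)) x (hsub _ hxc)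
    rw [neg_mul]
    refine (abs_le.mp ?_).1
    rw [abs_mul, abs_mul, hsabs, one_mul, mul_comm]
    exact mul_le_mul_of_nonneg_right hGA (abs_nonneg _)
  have hothers := Finset.sum_le_sum fun i' (hi' : i' ∈ Finset.univ.erase i) =>
    hother i' (Finset.ne_of_mem_erase hi')
  have hpoints := Finset.sum_le_sum fun j (_ : j ∈ Finset.univ) => hpoint j
  rw [← Finset.mul_sum] at hothers hpoints
  have hSle : ∑ i' ∈ Finset.univ.erase i, |κ (Fin.castAdd l i')| + |κ (Fin.castAdd l i)|
      + ∑ j, |κ (Fin.natAdd p j)| = S := by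
    rw [Finset.sum_erase_add _ _ (Finset.mem_univ i), hS, Fin.sum_univ_add]
  have hexpand : s i * (ψ (∑ i', ωs i') x + ∑ j, κ (Fin.natAdd p j) * G (z j) x) =
      ∑ i' ∈ Finset.univ.erase i, s i * (∫ y, G x y * ωs i' y) + s i * (∫ y, G x y * ωs i y)
        + ∑ j, s i * (κ (Fin.natAdd p j) * G (z j) x) := by
    rw [hψsum x hxD, mul_add, Finset.mul_sum, Finset.mul_sum,
      Finset.sum_erase_add _ _ (Finset.mem_univ i)]
  have hκS : |κ (Fin.castAdd l i)| ≤ S :=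
    Finset.single_le_sum (f := fun i => |κ i|) (fun j _ => abs_nonneg _) (Finset.mem_univ _)
  have hBκ := mul_le_mul_of_nonneg_left hκS hB0
  have hAκ := mul_nonneg hA0 (abs_nonneg (κ (Fin.castAdd l i)))
  change _ ≤ s i * (ψ (∑ i', ωs i') x + ∑ j, κ (Fin.natAdd p j) * G (z j) x)
  rw [hexpand]
  have hAS := congrArg (A * ·) hSle
  simp only [mul_add] at hAS
  have hdiv : |κ (Fin.castAdd l i)| / (2 * π) * Real.log δ =
      1 / (2 * π) * Real.log δ * |κ (Fin.castAdd l i)| := by ring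
  linarith
end
end
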